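/- arXiv:0809.0724 — 2 statements merged into one kernel-verified Lean document; each statement's English description precedes it below -/
import Mathlib

section
/- There exists a constant c > 0 such that every finite simple graph G whose treewidth is at least c·ℓ⁴·√(log ℓ) contains a grid-like-minor of order ℓ, for every integer ℓ ≥ 2. -/
open SimpleGraph

/-- `H` is a minor of `G`: there are nonempty, pairwise disjoint, connected
branch sets in `G`, one for each vertex of `H`, such that adjacent vertices
of `H` have an edge of `G` between their branch sets. -/
def MinorOf {α β : Type*} (H : SimpleGraph α) (G : SimpleGraph β) : Prop :=
  ∃ B : α → Set β,
    (Pairwise fun a b => Disjoint (B a) (B b)) ∧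
    (∀ a, (G.induce (B a)).Connected) ∧
    (∀ a b, H.Adj a b → ∃ u ∈ B a, ∃ v ∈ B b, G.Adj u v)

/-- A tree decomposition of a graph `G`. -/
structure TreeDecomp {V : Type} (G : SimpleGraph V) where
  ι : Type
  tree : SimpleGraph ι
  isTree : tree.IsTree
  bag : ι → Finset V
  mem_bag : ∀ v : V, ∃ i, v ∈ bag i
  adj_bag : ∀ u v : V, G.Adj u v → ∃ i, u ∈ bag i ∧ v ∈ bag i
  connected_bag : ∀ v : V, (tree.induce {i | v ∈ bag i}).Connected

/-- The width of a tree decomposition: maximum bag size minus one. -/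
noncomputable def TreeDecomp.width {V : Type} {G : SimpleGraph V}
    (td : TreeDecomp G) : ℕ :=
  sSup {n | ∃ i, n = (td.bag i).card} - 1

/-- The treewidth of a finite graph. -/
noncomputable def treewidth {V : Type} [Fintype V] (G : SimpleGraph V) : ℕ :=
  sInf {w | ∃ td : TreeDecomp G, td.width = w}

/-- A path in `G`, together with its endpoints. -/
def PathIn {V : Type} (G : SimpleGraph V) : Type := Σ u v : V, G.Path u v

/-- The set of vertices of a path. -/
def PathIn.verts {V : Type} {G : SimpleGraph V} (P : PathIn G) : Set V :=
  {v | v ∈ (P.2.2 : G.Walk P.1 P.2.1).support}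

/-- The intersection graph of a set of paths: two paths are adjacent iff they
are distinct and share a vertex. -/
def pathIntersectionGraph {V : Type} (G : SimpleGraph V)
    (𝒬 : Set (PathIn G)) : SimpleGraph 𝒬 :=
  SimpleGraph.fromRel fun P Q => ∃ v, v ∈ (P : PathIn G).verts ∧ v ∈ (Q : PathIn G).verts

/-- A grid-like-minor of order `ℓ` in `G`: a set of paths whose intersection
graph is bipartite and contains a `K_ℓ`-minor. -/
def IsGridLikeMinor {V : Type} (G : SimpleGraph V) (ℓ : ℕ)
    (𝒬 : Set (PathIn G)) : Prop :=
  (pathIntersectionGraph G 𝒬).Colorable 2 ∧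
    MinorOf (completeGraph (Fin ℓ)) (pathIntersectionGraph G 𝒬)

/-- Two subgraphs touch if they share a vertex or there is an edge of `G`
between them. -/
def Touch {V : Type} {G : SimpleGraph V} (X Y : G.Subgraph) : Prop :=
  (X.verts ∩ Y.verts).Nonempty ∨ ∃ u ∈ X.verts, ∃ v ∈ Y.verts, G.Adj u v

/-- A bramble: a set of pairwise touching connected subgraphs. -/
def IsBramble {V : Type} {G : SimpleGraph V} (ℬ : Set G.Subgraph) : Prop :=
  (∀ X ∈ ℬ, X.Connected) ∧ ∀ X ∈ ℬ, ∀ Y ∈ ℬ, Touch X Y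

/-- The order of a bramble is at least `k`: every hitting set has at least `k`
vertices. -/
def BrambleOrderAtLeast {V : Type} {G : SimpleGraph V} (ℬ : Set G.Subgraph)
    (k : ℕ) : Prop :=
  ∀ S : Finset V, (∀ X ∈ ℬ, ∃ v ∈ S, v ∈ X.verts) → k ≤ S.card

/-- The intersection graph of a set of subgraphs: two subgraphs are adjacent
iff they are distinct and share a vertex. -/
def subgraphIntersectionGraph {V : Type} (G : SimpleGraph V)
    (𝒳 : Set G.Subgraph) : SimpleGraph 𝒳 :=
  SimpleGraph.fromRel fun X Q => ((X : G.Subgraph).verts ∩ (Q : G.Subgraph).verts).Nonempty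

/-- A graph is `d`-degenerate if every nonempty (induced) subgraph has a vertex
of degree at most `d`. -/
def IsDegenerate {W : Type*} (d : ℕ) (G : SimpleGraph W) : Prop :=
  ∀ s : Set W, s.Nonempty → ∃ v ∈ s, {u | u ∈ s ∧ G.Adj v u}.ncard ≤ d

/-- The subgraph of `G` induced by `S` is connected. -/
def ConnSet {V : Type*} (G : SimpleGraph V) (S : Set V) : Prop := (G.induce S).Connected

theorem connSet_iff {V : Type*} {G : SimpleGraph V} {S : Set V} :
    ConnSet G S ↔ S.Nonempty ∧
      ∀ u ∈ S, ∀ v ∈ S, ∃ p : G.Walk u v, ∀ w ∈ p.support, w ∈ S := by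
  constructor
  · intro h
    refine ⟨Set.nonempty_coe_sort.mp h.nonempty, fun u hu v hv => ?_⟩
    obtain ⟨p⟩ := h.preconnected ⟨u, hu⟩ ⟨v, hv⟩
    refine ⟨p.map (Embedding.induce S).toHom, fun w hw => ?_⟩
    have hw' : w ∈ p.support.map (Embedding.induce (G := G) S).toHom := by
      rw [← Walk.support_map]
      exact hw
    obtain ⟨x, -, rfl⟩ := List.mem_map.mp hw'
    exact x.2
  · rintro ⟨⟨x, hx⟩, h⟩
    have : Nonempty S := ⟨⟨x, hx⟩⟩
    refine ⟨fun u v => ?_⟩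
    obtain ⟨p, hp⟩ := h u u.2 v v.2
    exact ⟨p.induce S hp⟩

theorem ConnSet.nonempty {V : Type*} {G : SimpleGraph V} {S : Set V} (h : ConnSet G S) :
    S.Nonempty := (connSet_iff.mp h).1

theorem ConnSet.exists_walk {V : Type*} {G : SimpleGraph V} {S : Set V} (h : ConnSet G S)
    {u v : V} (hu : u ∈ S) (hv : v ∈ S) : ∃ p : G.Walk u v, ∀ w ∈ p.support, w ∈ S :=
  (connSet_iff.mp h).2 u hu v hv

theorem ConnSet.exists_path {V : Type*} {G : SimpleGraph V} {S : Set V} (h : ConnSet G S)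
    {u v : V} (hu : u ∈ S) (hv : v ∈ S) :
    ∃ p : G.Walk u v, p.IsPath ∧ ∀ w ∈ p.support, w ∈ S := by
  classical
  obtain ⟨p, hp⟩ := h.exists_walk hu hv
  exact ⟨p.bypass, p.bypass_isPath, fun w hw => hp w (p.support_bypass_subset_support hw)⟩

theorem connSet_of_center {V : Type*} {G : SimpleGraph V} {S : Set V} {x : V} (hx : x ∈ S)
    (h : ∀ u ∈ S, ∃ p : G.Walk x u, ∀ w ∈ p.support, w ∈ S) : ConnSet G S := by
  refine connSet_iff.mpr ⟨⟨x, hx⟩, fun u hu v hv => ?_⟩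
  obtain ⟨p, hp⟩ := h u hu
  obtain ⟨q, hq⟩ := h v hv
  refine ⟨p.reverse.append q, fun w hw => ?_⟩
  rw [Walk.mem_support_append_iff, Walk.support_reverse, List.mem_reverse] at hw
  exact hw.elim (hp w) (hq w)

theorem connSet_singleton {V : Type*} (G : SimpleGraph V) (x : V) : ConnSet G {x} :=
  connSet_of_center rfl (by rintro u rfl; exact ⟨Walk.nil, by simp⟩)

theorem connSet_support {V : Type*} {G : SimpleGraph V} {u v : V} (p : G.Walk u v) :
    ConnSet G {w | w ∈ p.support} := p.connected_induce_support

theorem ConnSet.mono {V : Type*} {G H : SimpleGraph V} {S : Set V} (h : ConnSet G S)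
    (hGH : G ≤ H) : ConnSet H S :=
  Connected.mono (fun _ _ h => hGH h) h


theorem ConnSet.union {V : Type*} {G : SimpleGraph V} {S T : Set V} (hS : ConnSet G S)
    (hT : ConnSet G T) (h : (S ∩ T).Nonempty) : ConnSet G (S ∪ T) := by
  obtain ⟨x, hxS, hxT⟩ := h
  refine connSet_of_center (Or.inl hxS) ?_
  rintro u (hu | hu)
  · obtain ⟨p, hp⟩ := hS.exists_walk hxS hu
    exact ⟨p, fun w hw => Or.inl (hp w hw)⟩
  · obtain ⟨p, hp⟩ := hT.exists_walk hxT hu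
    exact ⟨p, fun w hw => Or.inr (hp w hw)⟩

theorem connSet_pair {V : Type*} {G : SimpleGraph V} {x y : V} (h : G.Adj x y) :
    ConnSet G {x, y} := by
  refine connSet_of_center (Or.inl rfl) ?_
  rintro u (rfl | rfl)
  · exact ⟨Walk.nil, by simp⟩
  · exact ⟨h.toWalk, by simp⟩

theorem ConnSet.union_of_adj {V : Type*} {G : SimpleGraph V} {S T : Set V} (hS : ConnSet G S)
    (hT : ConnSet G T) {x y : V} (hx : x ∈ S) (hy : y ∈ T) (h : G.Adj x y) :
    ConnSet G (S ∪ T) := by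
  have h1 := (hS.union (connSet_pair h) ⟨x, hx, Or.inl rfl⟩).union hT
    ⟨y, Or.inr (Or.inr rfl), hy⟩
  convert h1 using 1
  ext w
  simp only [Set.mem_union, Set.mem_insert_iff, Set.mem_singleton_iff]
  constructor
  · tauto
  · rintro ((h | rfl | rfl) | h) <;> tauto

/-- The set of vertices reachable from `u` inside `S`. -/
def reachIn {V : Type*} (G : SimpleGraph V) (S : Set V) (u : V) : Set V :=
  {v | ∃ p : G.Walk u v, ∀ w ∈ p.support, w ∈ S}

theorem reachIn_subset {V : Type*} {G : SimpleGraph V} {S : Set V} {u : V} :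
    reachIn G S u ⊆ S := fun _ ⟨p, hp⟩ => hp _ p.end_mem_support

theorem mem_reachIn_self {V : Type*} {G : SimpleGraph V} {S : Set V} {u : V} (hu : u ∈ S) :
    u ∈ reachIn G S u := ⟨Walk.nil, by simpa using hu⟩

theorem reachIn_of_adj {V : Type*} {G : SimpleGraph V} {S : Set V} {u v w : V}
    (hv : v ∈ reachIn G S u) (h : G.Adj v w) (hw : w ∈ S) : w ∈ reachIn G S u := by
  obtain ⟨p, hp⟩ := hv
  refine ⟨p.concat h, fun x hx => ?_⟩
  rw [Walk.support_concat, List.mem_append, List.mem_singleton] at hx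
  rcases hx with hx | rfl
  · exact hp x hx
  · exact hw

theorem connSet_reachIn {V : Type*} {G : SimpleGraph V} {S : Set V} {u : V} (hu : u ∈ S) :
    ConnSet G (reachIn G S u) := by
  classical
  refine connSet_of_center (mem_reachIn_self hu) ?_
  rintro v ⟨p, hp⟩
  refine ⟨p, fun w hw => ⟨p.takeUntil w hw, fun x hx => hp x ?_⟩⟩
  exact p.support_takeUntil_subset_support hw hx

theorem ConnSet.exists_boundary {V : Type*} {G : SimpleGraph V} {S R : Set V} (h : ConnSet G S)
    {u v : V} (huS : u ∈ S) (huR : u ∈ R) (hvS : v ∈ S) (hvR : v ∉ R) :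
    ∃ x y, x ∈ S ∧ x ∈ R ∧ y ∈ S ∧ y ∉ R ∧ G.Adj x y := by
  obtain ⟨p, hp⟩ := h.exists_walk huS hvS
  obtain ⟨d, hd, h1, h2⟩ := p.exists_boundary_dart R huR hvR
  exact ⟨d.fst, d.snd, hp _ (p.dart_fst_mem_support_of_mem_darts hd), h1,
    hp _ (p.dart_snd_mem_support_of_mem_darts hd), h2, d.adj⟩

/-- A connected set meeting `T` contains a connected set through a prescribed vertex
meeting `T` exactly once. -/
theorem ConnSet.exists_first_hit {V : Type*} {G : SimpleGraph V} {S T : Set V} (h : ConnSet G S)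
    {u : V} (hu : u ∈ S) (hT : (S ∩ T).Nonempty) (huT : u ∉ T) :
    ∃ R t, u ∈ R ∧ R ⊆ S \ T ∧ ConnSet G R ∧ t ∈ S ∧ t ∈ T ∧ ∃ r ∈ R, G.Adj r t := by
  obtain ⟨v, hvS, hvT⟩ := hT
  have hu' : u ∈ S \ T := ⟨hu, huT⟩
  obtain ⟨x, y, -, hx, hyS, hy, hxy⟩ := h.exists_boundary (R := reachIn G (S \ T) u) hu
    (mem_reachIn_self hu') hvS (fun hv => (reachIn_subset hv).2 hvT)
  refine ⟨reachIn G (S \ T) u, y, mem_reachIn_self hu', reachIn_subset, connSet_reachIn hu', hyS,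
    ?_, x, hx, hxy⟩
  by_contra hyT
  exact hy (reachIn_of_adj hx hxy ⟨hyS, hyT⟩)

/-- Every connected set meeting both `A` and `B` meets `S`. -/
def Separates {V : Type*} (G : SimpleGraph V) (A B S : Set V) : Prop :=
  ∀ Q : Set V, ConnSet G Q → (Q ∩ A).Nonempty → (Q ∩ B).Nonempty → (Q ∩ S).Nonempty

theorem Separates.symm {V : Type*} {G : SimpleGraph V} {A B S : Set V} (h : Separates G A B S) :
    Separates G B A S := fun Q hQ hB hA => h Q hQ hA hB

/-- A connected set avoiding an endpoint of every edge of `G` outside `G'` is connected in `G'`. -/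
theorem ConnSet.of_adj_imp {V : Type*} {G G' : SimpleGraph V} {S : Set V} (h : ConnSet G S)
    (h' : ∀ u ∈ S, ∀ v ∈ S, G.Adj u v → G'.Adj u v) : ConnSet G' S :=
  Connected.mono (fun u v huv => h' u u.2 v v.2 huv) h

/-- The vertices joined to `A` by a connected set avoiding `S`. -/
def reachSide {V : Type*} (G : SimpleGraph V) (A S : Set V) : Set V :=
  {w | ∃ Q, ConnSet G Q ∧ (Q ∩ A).Nonempty ∧ Disjoint Q S ∧ w ∈ Q}

/-- Suppose `S` separates `A` from `B` in `G'`, but `Q₀` is connected in `G`, meets `A` and `B`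
and avoids `S`.  Then some edge of `G` outside `G'` starts in the `A`-side. -/
theorem exists_crossing {V : Type*} {G G' : SimpleGraph V} {A B S Q₀ : Set V}
    (hS : Separates G' A B S) (hQ₀ : ConnSet G Q₀)
    (hA : (Q₀ ∩ A).Nonempty) (hB : (Q₀ ∩ B).Nonempty) (hQS : Disjoint Q₀ S) :
    ∃ x ∈ reachSide G' A S, ∃ y ∈ Q₀, G.Adj x y ∧ ¬ G'.Adj x y := by
  obtain ⟨a, haQ, haA⟩ := hA
  obtain ⟨b, hbQ, hbB⟩ := hB
  have hR := connSet_reachIn (G := G') haQ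
  have hRS : Disjoint (reachIn G' Q₀ a) S := hQS.mono_left reachIn_subset
  have hb : b ∉ reachIn G' Q₀ a := by
    intro hb
    obtain ⟨z, hz, hzS⟩ := hS _ hR ⟨a, mem_reachIn_self haQ, haA⟩ ⟨b, hb, hbB⟩
    exact hRS.le_bot ⟨hz, hzS⟩
  obtain ⟨x, y, -, hx, hyQ, hy, hxy⟩ := hQ₀.exists_boundary haQ (mem_reachIn_self haQ) hbQ hb
  exact ⟨x, ⟨_, hR, ⟨a, mem_reachIn_self haQ, haA⟩, hRS, hx⟩, y, hyQ, hxy,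
    fun h => hy (reachIn_of_adj hx h hyQ)⟩

/-- Restricting a family linking `A` to `T ⊇ S` so that, apart from `S`, it stays on the
`A`-side of `S`. -/
theorem exists_linkage_on_side {V : Type*} {G : SimpleGraph V} {A S : Set V} {T : Finset V}
    {n : ℕ} (hST : S ⊆ T) (hTS : ∀ t ∈ T, t ∉ S → t ∈ reachSide G A S) (hT : T.card = n)
    (Q : Fin n → Set V) (hd : Pairwise fun i j => Disjoint (Q i) (Q j))
    (hc : ∀ i, ConnSet G (Q i)) (hA : ∀ i, (Q i ∩ A).Nonempty) (hQT : ∀ i, (Q i ∩ T).Nonempty) :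
    ∃ P : T → Set V, (Pairwise fun i j => Disjoint (P i) (P j)) ∧ (∀ t, ConnSet G (P t)) ∧
      (∀ t, (P t ∩ A).Nonempty) ∧ (∀ t : T, (t : V) ∈ P t) ∧
      (∀ t, P t ⊆ reachSide G A S ∪ S) := by
  choose q hq hqT using hQT
  have hinj : Function.Injective (fun i => (⟨q i, hqT i⟩ : T)) := by
    intro i j hij
    by_contra hne
    have : q i = q j := congrArg Subtype.val hij
    exact (hd hne).le_bot ⟨hq i, this ▸ hq j⟩
  have hbij : Function.Bijective (fun i => (⟨q i, hqT i⟩ : T)) := by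
    rw [Fintype.bijective_iff_injective_and_card]
    exact ⟨hinj, by simp [hT]⟩
  have huniq : ∀ i t, t ∈ Q i → t ∈ T → t = q i := by
    intro i t ht htT
    obtain ⟨j, hj⟩ := hbij.2 ⟨t, htT⟩
    have hj' : q j = t := congrArg Subtype.val hj
    by_cases hij : i = j
    · rw [hij, hj']
    · exact absurd (hd hij) (fun h => h.le_bot ⟨ht, hj' ▸ hq j⟩)
  have key : ∀ i, ∃ P ⊆ Q i, ConnSet G P ∧ (P ∩ A).Nonempty ∧ q i ∈ P ∧
      P ⊆ reachSide G A S ∪ S := by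
    intro i
    have hqi : q i ∈ reachSide G A S ∪ S := by
      by_cases h : q i ∈ S
      · exact Or.inr h
      · exact Or.inl (hTS _ (hqT i) h)
    obtain ⟨a, haQ, haA⟩ := hA i
    by_cases haT : a ∈ T
    · have := huniq i a haQ haT
      subst this
      exact ⟨{q i}, by simpa using hq i, connSet_singleton _ _, ⟨q i, rfl, haA⟩, rfl, by
        simpa using hqi⟩
    · obtain ⟨R, t, haR, hR, hRc, htQ, htT, r, hr, hrt⟩ :=
        (hc i).exists_first_hit (T := (T : Set V)) haQ ⟨q i, hq i, hqT i⟩ haT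
      have := huniq i t htQ htT
      subst this
      refine ⟨R ∪ {q i}, ?_, hRc.union_of_adj (connSet_singleton _ _) hr rfl hrt,
        ⟨a, Or.inl haR, haA⟩, Or.inr rfl, ?_⟩
      · rintro w (hw | rfl)
        · exact (hR hw).1
        · exact hq i
      · rintro w (hw | rfl)
        · refine Or.inl ⟨R, hRc, ⟨a, haR, haA⟩, ?_, hw⟩
          rw [Set.disjoint_left]
          exact fun z hz hzS => (hR hz).2 (hST hzS)
        · exact hqi
  choose P hPQ hPc hPA hqP hPS using key
  let e := Equiv.ofBijective _ hbij
  refine ⟨fun t => P (e.symm t), fun t t' htt' => ?_, fun t => hPc _, fun t => hPA _, fun t => ?_,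
    fun t => hPS _⟩
  · exact (hd (e.symm.injective.ne htt')).mono (hPQ _) (hPQ _)
  · have h1 : e (e.symm t) = t := e.apply_symm_apply t
    have h2 : q (e.symm t) = t := congrArg Subtype.val h1
    have h3 := hqP (e.symm t)
    rwa [h2] at h3

/-- **Menger's theorem**, with connected sets in place of paths. -/
theorem menger {V : Type*} [Finite V] (n : ℕ) :
    ∀ (m : ℕ) (G : SimpleGraph V), G.edgeSet.ncard ≤ m → ∀ A B : Set V,
      (∀ S : Finset V, Separates G A B S → n ≤ S.card) →
      ∃ Q : Fin n → Set V, (Pairwise fun i j => Disjoint (Q i) (Q j)) ∧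
        (∀ i, ConnSet G (Q i)) ∧ (∀ i, (Q i ∩ A).Nonempty) ∧ ∀ i, (Q i ∩ B).Nonempty := by
  classical
  have := Fintype.ofFinite V
  intro m
  induction m with
  | zero =>
    intro G hG A B hsep
    have hG0 : G = ⊥ := by
      rw [← edgeSet_eq_empty, ← Set.ncard_eq_zero]
      omega
    subst hG0
    have h1 := hsep (A ∩ B).toFinset (by
      intro Q hQ hA hB
      obtain ⟨a, haQ, haA⟩ := hA
      obtain ⟨b, hbQ, hbB⟩ := hB
      have hab : a = b := by
        obtain ⟨p, -⟩ := hQ.exists_walk haQ hbQ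
        cases p with
        | nil => rfl
        | cons h _ => exact absurd h (by simp)
      subst hab
      exact ⟨a, haQ, by simpa using ⟨haA, hbB⟩⟩)
    obtain ⟨s, hs, hcard⟩ := Finset.exists_subset_card_eq h1
    let e := (s.equivFinOfCardEq hcard).symm
    refine ⟨fun i => {(e i : V)}, fun i j hij => ?_, fun i => connSet_singleton _ _,
      fun i => ?_, fun i => ?_⟩
    · exact Set.disjoint_singleton.mpr fun h => hij (e.injective (Subtype.ext h))
    · have := hs (e i).2
      simp only [Set.mem_toFinset] at this
      exact ⟨_, rfl, this.1⟩
    · have := hs (e i).2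
      simp only [Set.mem_toFinset] at this
      exact ⟨_, rfl, this.2⟩
  | succ m ih =>
    intro G hG A B hsep
    by_cases hm : G.edgeSet.ncard ≤ m
    · exact ih G hm A B hsep
    have hne : G.edgeSet.Nonempty := by
      rw [← Set.ncard_pos]
      omega
    obtain ⟨e, he⟩ := hne
    set G' := G.deleteEdges {e} with hG'
    have hle : G' ≤ G := deleteEdges_le _
    have hG'm : G'.edgeSet.ncard ≤ m := by
      rw [hG', edgeSet_deleteEdges, Set.ncard_sdiff_singleton_of_mem he]
      omega
    have hedge : ∀ {u v}, G.Adj u v → ¬ G'.Adj u v → s(u, v) = e := by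
      intro u v h h'
      by_contra hne
      exact h' (by rw [hG', deleteEdges_adj]; exact ⟨h, by simpa using hne⟩)
    by_cases hG'sep : ∀ S : Finset V, Separates G' A B S → n ≤ S.card
    · obtain ⟨Q, h1, h2, h3⟩ := ih G' hG'm A B hG'sep
      exact ⟨Q, h1, fun i => (h2 i).mono hle, h3⟩
    push Not at hG'sep
    obtain ⟨S, hS, hSn⟩ := hG'sep
    have hnot : ¬ Separates G A B S := fun h => absurd (hsep S h) (by omega)
    unfold Separates at hnot
    push Not at hnot
    obtain ⟨Q₀, hQ₀, hQ₀A, hQ₀B, hQ₀S⟩ := hnot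
    have hQ₀S : Disjoint Q₀ (S : Set V) := Set.disjoint_iff_inter_eq_empty.mpr hQ₀S
    have hdisj : ∀ w, w ∈ reachSide G' A S → w ∈ reachSide G' B S → False := by
      rintro w ⟨Q, hQ, hQA, hQS, hwQ⟩ ⟨R, hR, hRB, hRS, hwR⟩
      obtain ⟨z, hz, hzS⟩ := hS (Q ∪ R) (hQ.union hR ⟨w, hwQ, hwR⟩)
        (hQA.mono (Set.inter_subset_inter_left _ Set.subset_union_left))
        (hRB.mono (Set.inter_subset_inter_left _ Set.subset_union_right))
      rcases hz with hz | hz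
      · exact hQS.le_bot ⟨hz, hzS⟩
      · exact hRS.le_bot ⟨hz, hzS⟩
    obtain ⟨x, hxA, x', -, hxx', hnxx'⟩ := exists_crossing hS hQ₀ hQ₀A hQ₀B hQ₀S
    obtain ⟨y, hyB, y', -, hyy', hnyy'⟩ := exists_crossing hS.symm hQ₀ hQ₀B hQ₀A hQ₀S
    have hxy : x' = y := by
      have := (hedge hxx' hnxx').trans (hedge hyy' hnyy').symm
      rw [Sym2.eq_iff] at this
      rcases this with ⟨h, -⟩ | ⟨-, h⟩
      · exact (hdisj x hxA (h ▸ hyB)).elim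
      · exact h
    subst hxy
    have he' := hedge hxx' hnxx'
    have hxS : x ∉ S := by
      obtain ⟨Q, -, -, hQS, hw⟩ := hxA
      exact fun h => hQS.le_bot ⟨hw, h⟩
    have hyS : x' ∉ S := by
      obtain ⟨Q, -, -, hQS, hw⟩ := hyB
      exact fun h => hQS.le_bot ⟨hw, h⟩
    -- separators of `G'` between `A` and `S ∪ {z}`
    have main : ∀ (z z' : V) (A B : Set V), (∀ S : Finset V, Separates G A B S → n ≤ S.card) →
        Separates G' A B S → z ∉ S → s(z, z') = e → z' ∉ reachSide G' A S →
        z ∈ reachSide G' A S →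
        (insert z S : Finset V).card = n ∧ ∃ P : ↥(insert z S : Finset V) → Set V,
          (Pairwise fun i j => Disjoint (P i) (P j)) ∧
          (∀ t, ConnSet G' (P t)) ∧ (∀ t, (P t ∩ A).Nonempty) ∧ (∀ t, (t : V) ∈ P t) ∧
          (∀ t, P t ⊆ reachSide G' A S ∪ S) := by
      intro z z' A B hsep hS hzS hzz' hz' hz
      have havoid : ∀ Q, ConnSet G Q → z ∉ Q → ConnSet G' Q := by
        intro Q hQ hzQ
        refine hQ.of_adj_imp fun u hu v hv huv => ?_
        by_contra h
        have := (hedge huv h).trans hzz'.symm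
        rw [Sym2.eq_iff] at this
        rcases this with ⟨rfl, -⟩ | ⟨-, rfl⟩
        · exact hzQ hu
        · exact hzQ hv
      have hT : Separates G A B (insert z S : Finset V) := by
        intro Q hQ hA hB
        by_cases hzQ : z ∈ Q
        · exact ⟨z, hzQ, by simp⟩
        · obtain ⟨w, hw, hwS⟩ := hS Q (havoid Q hQ hzQ) hA hB
          exact ⟨w, hw, by simpa using Or.inr hwS⟩
      have hTcard : (insert z S : Finset V).card = n := by
        have h1 := hsep _ hT
        have h2 := Finset.card_insert_le z S
        omega
      have hsep' : ∀ Z : Finset V, Separates G' A (insert z S : Finset V) Z → n ≤ Z.card := by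
        intro Z hZ
        apply hsep
        intro Q hQ hA hB
        obtain ⟨a, haQ, haA⟩ := hA
        have hR := connSet_reachIn (G := G') haQ
        by_cases hRT : (reachIn G' Q a ∩ (insert z S : Finset V)).Nonempty
        · obtain ⟨w, hw, hwZ⟩ := hZ _ hR ⟨a, mem_reachIn_self haQ, haA⟩ hRT
          exact ⟨w, reachIn_subset hw, hwZ⟩
        · exfalso
          have hRS : Disjoint (reachIn G' Q a) S := by
            rw [Set.disjoint_left]
            exact fun w hw hwS => hRT ⟨w, hw, by simpa using Or.inr hwS⟩
          have hzR : z ∉ reachIn G' Q a := fun h => hRT ⟨z, h, by simp⟩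
          obtain ⟨b, hbQ, hbB⟩ := hB
          have hbR : b ∉ reachIn G' Q a := by
            intro hb
            obtain ⟨w, hw, hwS⟩ := hS _ hR ⟨a, mem_reachIn_self haQ, haA⟩ ⟨b, hb, hbB⟩
            exact hRS.le_bot ⟨hw, hwS⟩
          obtain ⟨u, v, -, hu, hvQ, hv, huv⟩ :=
            hQ.exists_boundary haQ (mem_reachIn_self haQ) hbQ hbR
          have h1 := (hedge huv fun h => hv (reachIn_of_adj hu h hvQ)).trans hzz'.symm
          rw [Sym2.eq_iff] at h1
          rcases h1 with ⟨rfl, -⟩ | ⟨rfl, -⟩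
          · exact hzR hu
          · exact hz' ⟨_, hR, ⟨a, mem_reachIn_self haQ, haA⟩, hRS, hu⟩
      obtain ⟨Q, h1, h2, h3, h4⟩ := ih G' hG'm A _ hsep'
      refine ⟨hTcard, exists_linkage_on_side (T := insert z S)
        (by simp) ?_ hTcard Q h1 h2 h3 h4⟩
      intro t ht htS
      simp only [Finset.mem_insert] at ht
      rcases ht with rfl | ht
      · exact hz
      · exact absurd ht htS
    obtain ⟨hcard, P, hPd, hPc, hPA, hPt, hPs⟩ :=
      main x x' A B hsep hS hxS he' (fun h => hdisj _ h hyB) hxA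
    obtain ⟨-, R, hRd, hRc, hRB, hRt, hRs⟩ := main x' x B A (fun S h => hsep S h.symm) hS.symm hyS
      (by rw [Sym2.eq_swap]; exact he') (fun h => hdisj _ hxA h) hyB
    let σ : ↥(insert x S : Finset V) → (insert x' S : Finset V) := fun t =>
      if h : (t : V) ∈ S then ⟨t, by simp [h]⟩ else ⟨x', by simp⟩
    have hσ1 : ∀ t : ↥(insert x S : Finset V), (t : V) ∈ S → (σ t : V) = t := by
      intro t ht; simp [σ, ht]
    have hσ2 : ∀ t : ↥(insert x S : Finset V), (t : V) ∉ S → (σ t : V) = x' := by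
      intro t ht; simp [σ, ht]
    have hT : ∀ t : (insert x S : Finset V), (t : V) ∉ S → (t : V) = x := by
      intro t ht
      have := t.2
      simp only [Finset.mem_insert] at this
      tauto
    have hσinj : Function.Injective σ := by
      intro t t' h
      have h' : (σ t : V) = σ t' := congrArg _ h
      apply Subtype.ext
      by_cases h1 : (t : V) ∈ S <;> by_cases h2 : (t' : V) ∈ S
      · rwa [hσ1 t h1, hσ1 t' h2] at h'
      · rw [hσ1 t h1, hσ2 t' h2] at h'
        exact absurd (h' ▸ h1) hyS
      · rw [hσ2 t h1, hσ1 t' h2] at h'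
        exact absurd (h' ▸ h2) hyS
      · rw [hT t h1, hT t' h2]
    have hcross : ∀ t t' w, w ∈ P t → w ∈ R (σ t') → t = t' := by
      intro t t' w hw hw'
      have hwS : w ∈ S := by
        rcases hPs _ hw with h1 | h1
        · rcases hRs _ hw' with h2 | h2
          · exact (hdisj _ h1 h2).elim
          · exact h2
        · exact h1
      have h1 : t = ⟨w, by simp [hwS]⟩ := by
        by_contra h
        exact (hPd h).le_bot ⟨hw, hPt ⟨w, by simp [hwS]⟩⟩
      have h2 : σ t' = ⟨w, by simp [hwS]⟩ := by
        by_contra h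
        exact (hRd h).le_bot ⟨hw', hRt ⟨w, by simp [hwS]⟩⟩
      apply hσinj
      rw [h2]
      apply Subtype.ext
      rw [hσ1 t (by rw [h1]; exact hwS), h1]
    let f := ((insert x S : Finset V).equivFinOfCardEq hcard).symm
    refine ⟨fun i => P (f i) ∪ R (σ (f i)), fun i j hij => ?_, fun i => ?_, fun i => ?_,
      fun i => ?_⟩
    · have hf := f.injective.ne hij
      refine Set.disjoint_left.mpr ?_
      rintro w (hw | hw) (hw' | hw')
      · exact (hPd hf).le_bot ⟨hw, hw'⟩
      · exact hf (hcross _ _ w hw hw')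
      · exact hf (hcross _ _ w hw' hw).symm
      · exact (hRd (hσinj.ne hf)).le_bot ⟨hw, hw'⟩
    · by_cases h : (f i : V) ∈ S
      · refine ((hPc _).mono hle).union ((hRc _).mono hle) ⟨f i, hPt _, ?_⟩
        have := hRt (σ (f i))
        rwa [hσ1 _ h] at this
      · refine ((hPc _).mono hle).union_of_adj ((hRc _).mono hle) (hPt _) (hRt _) ?_
        rw [hσ2 _ h, hT _ h]
        exact hxx'
    · exact (hPA _).mono (Set.inter_subset_inter_left _ Set.subset_union_left)
    · exact (hRB _).mono (Set.inter_subset_inter_left _ Set.subset_union_right)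

theorem ConnSet.union_neighbors {V : Type*} {G : SimpleGraph V} {D N : Set V} (hD : ConnSet G D)
    (hN : ∀ y ∈ N, ∃ x ∈ D, G.Adj x y) : ConnSet G (D ∪ N) := by
  obtain ⟨x₀, hx₀⟩ := hD.nonempty
  refine connSet_of_center (Or.inl hx₀) ?_
  rintro u (hu | hu)
  · obtain ⟨p, hp⟩ := hD.exists_walk hx₀ hu
    exact ⟨p, fun w hw => Or.inl (hp w hw)⟩
  · obtain ⟨x, hx, hxu⟩ := hN u hu
    obtain ⟨p, hp⟩ := hD.exists_walk hx₀ hx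
    refine ⟨p.concat hxu, fun w hw => ?_⟩
    rw [Walk.support_concat, List.mem_append, List.mem_singleton] at hw
    rcases hw with hw | rfl
    · exact Or.inl (hp w hw)
    · exact Or.inr hu

/-- The tree on `Fin n` in which every nonzero `i` is joined to `par i`. -/
def parentGraph (n : ℕ) (par : ℕ → ℕ) : SimpleGraph (Fin n) :=
  SimpleGraph.fromRel fun i j => 0 < (j : ℕ) ∧ (i : ℕ) = par j

theorem connSet_parentGraph {n : ℕ} {par : ℕ → ℕ} (hpar : ∀ i < n, 0 < i → par i < i)
    {S : Set (Fin n)} (hne : S.Nonempty)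
    (hS : ∀ i ∈ S, ∀ j ∈ S, j < i → ∃ p ∈ S, (p : ℕ) = par i) :
    ConnSet (parentGraph n par) S := by
  obtain ⟨i₀, hi₀, hmin⟩ := S.toFinite.exists_minimal hne
  refine connSet_of_center hi₀ ?_
  have hmin' : ∀ i ∈ S, i₀ ≤ i := fun i hi => by
    rcases le_total i₀ i with h | h
    · exact h
    · exact hmin hi h
  suffices h : ∀ m : ℕ, ∀ i ∈ S, (i : ℕ) = m →
      ∃ p : (parentGraph n par).Walk i₀ i, ∀ w ∈ p.support, w ∈ S from
    fun i hi => h i i hi rfl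
  intro m
  induction m using Nat.strong_induction_on with
  | _ m ih =>
    intro i hi him
    by_cases hii : i = i₀
    · subst hii
      exact ⟨Walk.nil, by simpa using hi⟩
    · have hlt : i₀ < i := lt_of_le_of_ne (hmin' i hi) (Ne.symm hii)
      have hi0 : 0 < (i : ℕ) := lt_of_le_of_lt (Nat.zero_le _) hlt
      obtain ⟨p, hpS, hp⟩ := hS i hi i₀ hi₀ hlt
      have hpi : (p : ℕ) < i := hp ▸ hpar i i.2 hi0
      obtain ⟨q, hq⟩ := ih p (him ▸ hpi) p hpS rfl
      have hadj : (parentGraph n par).Adj p i := by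
        rw [parentGraph, fromRel_adj]
        exact ⟨fun h => by simp [h] at hpi, Or.inl ⟨hi0, hp⟩⟩
      refine ⟨q.concat hadj, fun w hw => ?_⟩
      rw [Walk.support_concat, List.mem_append, List.mem_singleton] at hw
      rcases hw with hw | rfl
      · exact hq w hw
      · exact hi

theorem isTree_parentGraph {n : ℕ} {par : ℕ → ℕ} (hn : 0 < n)
    (hpar : ∀ i < n, 0 < i → par i < i) : (parentGraph n par).IsTree := by
  classical
  have hconn : (parentGraph n par).Connected := by
    have h : ConnSet (parentGraph n par) Set.univ := by
      refine connSet_parentGraph hpar ⟨⟨0, hn⟩, trivial⟩ fun i _ j _ hji => ?_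
      have h1 := hpar i i.2 (lt_of_le_of_lt (Nat.zero_le _) hji)
      exact ⟨⟨par i, h1.trans i.2⟩, trivial, rfl⟩
    exact (induceUnivIso _).connected_iff.mp h
  rw [isTree_iff_connected_and_card]
  refine ⟨hconn, le_antisymm ?_ ?_⟩
  · have hsub : (parentGraph n par).edgeSet ⊆
        (fun i : Fin n => s(i, if h : par i < n then ⟨par i, h⟩ else i)) '' {i | 0 < (i : ℕ)} := by
      intro e
      induction e using Sym2.ind with
      | _ a b =>
        intro h
        rw [mem_edgeSet, parentGraph, fromRel_adj] at h
        rcases h with ⟨-, ⟨h0, h⟩ | ⟨h0, h⟩⟩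
        · refine ⟨b, h0, ?_⟩
          have : par b < n := h ▸ a.2
          simp only [this, dite_true]
          rw [Sym2.eq_swap]
          congr 1
          simp [← h]
        · refine ⟨a, h0, ?_⟩
          have : par a < n := h ▸ b.2
          simp only [this, dite_true]
          congr 1
          simp [← h]
    have h1 := (Set.ncard_le_ncard hsub (Set.toFinite _)).trans
      (Set.ncard_image_le (Set.toFinite _))
    have h2 : {i : Fin n | 0 < (i : ℕ)}.ncard < Nat.card (Fin n) := by
      rw [← Set.ncard_univ]
      refine Set.ncard_lt_ncard ?_ (Set.toFinite _)
      rw [Set.ssubset_univ_iff]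
      intro h
      have : (⟨0, hn⟩ : Fin n) ∈ {i : Fin n | 0 < (i : ℕ)} := h ▸ trivial
      simp at this
    rw [Nat.card_coe_set_eq]
    omega
  · exact hconn.card_vert_le_card_edgeSet_add_one

/-- A tree decomposition of `G[U]` with bags of size at most `3k + 1` such that every component
outside `U` has at most `2k` neighbours, all of them in one bag. -/
structure PartialDecomp {V : Type} (G : SimpleGraph V) (k n : ℕ) (bag : ℕ → Finset V)
    (par : ℕ → ℕ) (U : Set V) : Prop where
  par_lt : ∀ i < n, 0 < i → par i < i
  running : ∀ i < n, ∀ j < i, ∀ v ∈ bag i, v ∈ bag j → v ∈ bag (par i)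
  card_le : ∀ i < n, (bag i).card ≤ 3 * k + 1
  mem_iff : ∀ v, v ∈ U ↔ ∃ i < n, v ∈ bag i
  adj_bag : ∀ u ∈ U, ∀ v ∈ U, G.Adj u v → ∃ i < n, u ∈ bag i ∧ v ∈ bag i
  comp : ∀ D, ConnSet G D → Disjoint D U → (∀ x ∈ D, ∀ y, G.Adj x y → y ∈ D ∨ y ∈ U) →
    {y | y ∈ U ∧ ∃ x ∈ D, G.Adj x y}.ncard ≤ 2 * k ∧
    ∃ i < n, ∀ y ∈ U, (∃ x ∈ D, G.Adj x y) → y ∈ bag i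

theorem PartialDecomp.extend {V : Type} [Fintype V] {G : SimpleGraph V} {k : ℕ}
    (hsep : ∀ W : Finset V, W.card = 2 * k + 1 → ∃ Z : Finset V, Z.card ≤ k ∧
      ∀ D : Set V, ConnSet G D → Disjoint D (Z : Set V) → (D ∩ W).ncard ≤ k)
    {n : ℕ} {bag : ℕ → Finset V} {par : ℕ → ℕ} {U : Set V}
    (h : PartialDecomp G k n bag par U) {v : V} (hv : v ∉ U) :
    ∃ bag' par' U', PartialDecomp G k (n + 1) bag' par' U' ∧ insert v U ⊆ U' := by
  classical
  set C := reachIn G Uᶜ v with hC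
  have hCc : ConnSet G C := connSet_reachIn hv
  have hCU : Disjoint C U := by
    rw [← Set.subset_compl_iff_disjoint_right]
    exact reachIn_subset
  have hCcl : ∀ x ∈ C, ∀ y, G.Adj x y → y ∈ C ∨ y ∈ U := by
    intro x hx y hxy
    by_cases hy : y ∈ U
    · exact Or.inr hy
    · exact Or.inl (reachIn_of_adj hx hxy hy)
  obtain ⟨hN, i₀, hi₀, hN'⟩ := h.comp C hCc hCU hCcl
  set W : Finset V := {y | y ∈ U ∧ ∃ x ∈ C, G.Adj x y}.toFinset with hW
  have hWmem : ∀ y, y ∈ W ↔ y ∈ U ∧ ∃ x ∈ C, G.Adj x y := by simp [hW]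
  have hWcard : W.card ≤ 2 * k := by
    rw [hW, ← Set.ncard_eq_toFinset_card']
    exact hN
  set W₁ := insert v W with hW₁
  have hW₁card : W₁.card ≤ 2 * k + 1 := (Finset.card_insert_le _ _).trans (by omega)
  obtain ⟨Z, hZ, hZW⟩ : ∃ Z : Finset V, Z.card ≤ k ∧ ((Z = ∅ ∧ W₁.card ≤ 2 * k) ∨
      ∀ D : Set V, ConnSet G D → Disjoint D (Z : Set V) → (D ∩ W₁).ncard ≤ k) := by
    by_cases hc : W₁.card = 2 * k + 1
    · obtain ⟨Z, h1, h2⟩ := hsep W₁ hc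
      exact ⟨Z, h1, Or.inr h2⟩
    · exact ⟨∅, by simp, Or.inl ⟨rfl, by omega⟩⟩
  set X := W₁ ∪ Z.filter (· ∈ C) with hX
  have hvX : v ∈ X := by simp [hX, hW₁]
  have hWX : ∀ y ∈ W, y ∈ X := fun y hy => by simp [hX, hW₁, hy]
  have hZX : ∀ y ∈ Z, y ∈ C → y ∈ X := fun y hy hyC => by simp [hX, hy, hyC]
  have hvC : v ∈ C := mem_reachIn_self hv
  have hXcases : ∀ y ∈ X, y ∈ W ∨ y ∈ C := by
    intro y hy
    simp only [hX, hW₁, Finset.mem_union, Finset.mem_insert, Finset.mem_filter] at hy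
    rcases hy with (rfl | hy) | ⟨-, hy⟩
    · exact Or.inr hvC
    · exact Or.inl hy
    · exact Or.inr hy
  have hXUW : ∀ y ∈ X, y ∈ U → y ∈ W := by
    intro y hy hyU
    rcases hXcases y hy with h | h
    · exact h
    · exact (hCU.le_bot ⟨h, hyU⟩).elim
  have hbag : ∀ i < n, Function.update bag n X i = bag i := fun i hi =>
    Function.update_of_ne hi.ne _ _
  have hbagn : Function.update bag n X n = X := Function.update_self _ _ _
  have hparl : ∀ i < n, Function.update par n i₀ i = par i := fun i hi =>
    Function.update_of_ne hi.ne _ _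
  have hparn : Function.update par n i₀ n = i₀ := Function.update_self _ _ _
  refine ⟨Function.update bag n X, Function.update par n i₀, U ∪ X, ?_, ?_⟩
  · constructor
    · intro i hi h0
      rcases Nat.lt_succ_iff_lt_or_eq.mp hi with hi | rfl
      · rw [hparl i hi]; exact h.par_lt i hi h0
      · rw [hparn]; exact hi₀
    · intro i hi j hj w hw hwj
      rcases Nat.lt_succ_iff_lt_or_eq.mp hi with hi | rfl
      · rw [hbag i hi] at hw
        rw [hbag j (hj.trans hi)] at hwj
        rw [hparl i hi, hbag _ ((h.par_lt i hi (by omega)).trans hi)]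
        exact h.running i hi j hj w hw hwj
      · rw [hbagn] at hw
        rw [hbag j hj] at hwj
        rw [hparn, hbag _ hi₀]
        have hwU : w ∈ U := (h.mem_iff w).mpr ⟨j, hj, hwj⟩
        exact hN' w hwU ((hWmem w).mp (hXUW w hw hwU)).2
    · intro i hi
      rcases Nat.lt_succ_iff_lt_or_eq.mp hi with hi | rfl
      · rw [hbag i hi]; exact h.card_le i hi
      · rw [hbagn, hX]
        have h1 := Finset.card_union_le W₁ (Z.filter (· ∈ C))
        have h2 := Finset.card_filter_le Z (· ∈ C)
        omega
    · intro w
      constructor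
      · rintro (hw | hw)
        · obtain ⟨i, hi, hwi⟩ := (h.mem_iff w).mp hw
          exact ⟨i, by omega, by rwa [hbag i hi]⟩
        · exact ⟨n, by omega, by rwa [hbagn]⟩
      · rintro ⟨i, hi, hw⟩
        rcases Nat.lt_succ_iff_lt_or_eq.mp hi with hi | rfl
        · rw [hbag i hi] at hw
          exact Or.inl ((h.mem_iff w).mpr ⟨i, hi, hw⟩)
        · rw [hbagn] at hw
          exact Or.inr hw
    · have hmix : ∀ u ∈ U, ∀ w ∈ X, G.Adj u w → u ∈ X ∨ w ∈ U := by
        intro u hu w hw huw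
        rcases hXcases w hw with h1 | h1
        · exact Or.inr ((hWmem w).mp h1).1
        · exact Or.inl (hWX u ((hWmem u).mpr ⟨hu, w, h1, huw.symm⟩))
      have hold : ∀ u ∈ U, ∀ w ∈ U, G.Adj u w → ∃ i < n + 1,
          u ∈ Function.update bag n X i ∧ w ∈ Function.update bag n X i := by
        intro u hu w hw huw
        obtain ⟨i, hi, h1, h2⟩ := h.adj_bag u hu w hw huw
        exact ⟨i, by omega, by rwa [hbag i hi], by rwa [hbag i hi]⟩
      have hnew : ∀ u ∈ X, ∀ w ∈ X, ∃ i < n + 1,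
          u ∈ Function.update bag n X i ∧ w ∈ Function.update bag n X i :=
        fun u hu w hw => ⟨n, by omega, by rwa [hbagn], by rwa [hbagn]⟩
      rintro u (hu | hu) w (hw | hw) huw
      · exact hold u hu w hw huw
      · rcases hmix u hu w hw huw with h1 | h1
        · exact hnew u h1 w hw
        · exact hold u hu w h1 huw
      · rcases hmix w hw u hu huw.symm with h1 | h1
        · exact hnew u hu w h1
        · exact hold u h1 w hw huw
      · exact hnew u hu w hw
    · intro D hD hDU hDcl
      have hDU' : Disjoint D U := hDU.mono_right Set.subset_union_left
      by_cases hDC : Disjoint D C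
      · have hcl : ∀ x ∈ D, ∀ y, G.Adj x y → y ∈ D ∨ y ∈ U := by
          intro x hx y hxy
          rcases hDcl x hx y hxy with h1 | h1 | h1
          · exact Or.inl h1
          · exact Or.inr h1
          · rcases hXcases y h1 with h2 | h2
            · exact Or.inr ((hWmem y).mp h2).1
            · rcases hCcl y h2 x hxy.symm with h3 | h3
              · exact (hDC.le_bot ⟨hx, h3⟩).elim
              · exact (hDU'.le_bot ⟨hx, h3⟩).elim
        have hU : ∀ y ∈ U ∪ (X : Set V), (∃ x ∈ D, G.Adj x y) → y ∈ U := by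
          rintro y hy ⟨x, hx, hxy⟩
          rcases hcl x hx y hxy with h1 | h1
          · exact (hDU.le_bot ⟨h1, hy⟩).elim
          · exact h1
        obtain ⟨h1, i, hi, h2⟩ := h.comp D hD hDU' hcl
        refine ⟨le_trans (Set.ncard_le_ncard ?_ (Set.toFinite _)) h1, i, by omega, ?_⟩
        · rintro y ⟨hy, hy'⟩
          exact ⟨hU y hy hy', hy'⟩
        · intro y hy hy'
          rw [hbag i hi]
          exact h2 y (hU y hy hy') hy'
      · have hDsub : D ⊆ C := by
          obtain ⟨x, hxD, hxC⟩ := Set.not_disjoint_iff.mp hDC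
          by_contra hns
          obtain ⟨y, hyD, hyC⟩ := Set.not_subset.mp hns
          obtain ⟨a, b, -, haC, hbD, hbC, hab⟩ := hD.exists_boundary hxD hxC hyD hyC
          rcases hCcl a haC b hab with h1 | h1
          · exact hbC h1
          · exact hDU'.le_bot ⟨hbD, h1⟩
        have hDX : ∀ x ∈ D, x ∉ X := fun x hx hxX => hDU.le_bot ⟨hx, Or.inr hxX⟩
        have hNX : ∀ y ∈ U ∪ (X : Set V), (∃ x ∈ D, G.Adj x y) → y ∈ X := by
          rintro y (hy | hy) ⟨x, hx, hxy⟩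
          · exact hWX y ((hWmem y).mpr ⟨hy, x, hDsub hx, hxy⟩)
          · exact hy
        refine ⟨?_, n, by omega, fun y hy hy' => by rw [hbagn]; exact hNX y hy hy'⟩
        set N := {y | y ∈ U ∪ (X : Set V) ∧ ∃ x ∈ D, G.Adj x y} with hNdef
        have hXW : ∀ y ∈ X, y ∉ Z → y ∈ W₁ := by
          intro y hy hyZ
          simp only [hX, Finset.mem_union, Finset.mem_filter] at hy
          tauto
        rcases hZW with ⟨hZ0, hW₁c⟩ | hZW
        · refine le_trans ?_ hW₁c
          rw [← Set.ncard_coe_finset]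
          refine Set.ncard_le_ncard ?_ (Set.toFinite _)
          rintro y ⟨hy, hy'⟩
          exact hXW y (hNX y hy hy') (by simp [hZ0])
        · have hDZ : Disjoint (D ∪ (N \ Z)) (Z : Set V) := by
            rw [Set.disjoint_left]
            rintro y (hy | hy) hyZ
            · exact hDX y hy (hZX y hyZ (hDsub hy))
            · exact hy.2 hyZ
          have h1 := hZW (D ∪ (N \ Z)) (hD.union_neighbors fun y hy => hy.1.2) hDZ
          have h2 : (N \ Z).ncard ≤ k := by
            refine le_trans (Set.ncard_le_ncard ?_ (Set.toFinite _)) h1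
            exact fun y hy => ⟨Or.inr hy, hXW y (hNX y hy.1.1 hy.1.2) hy.2⟩
          have h3 : (N ∩ Z).ncard ≤ k := by
            refine le_trans ?_ hZ
            rw [← Set.ncard_coe_finset]
            exact Set.ncard_le_ncard Set.inter_subset_right (Set.toFinite _)
          have h4 := Set.ncard_inter_add_ncard_sdiff_eq_ncard N (Z : Set V) (Set.toFinite _)
          omega
  · rintro w (rfl | hw)
    · exact Or.inr hvX
    · exact Or.inl hw

theorem treewidth_le_of_balanced_separators {V : Type} [Fintype V] (G : SimpleGraph V) (k : ℕ)
    (hsep : ∀ W : Finset V, W.card = 2 * k + 1 → ∃ Z : Finset V, Z.card ≤ k ∧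
      ∀ D : Set V, ConnSet G D → Disjoint D (Z : Set V) → (D ∩ W).ncard ≤ k) :
    treewidth G ≤ 3 * k := by
  classical
  have key : ∀ m n bag par U, PartialDecomp G k n bag par U → 0 < n → Uᶜ.ncard ≤ m →
      ∃ n bag par, PartialDecomp G k n bag par Set.univ ∧ 0 < n := by
    intro m
    induction m with
    | zero =>
      intro n bag par U h hn hU
      have : U = Set.univ := by
        rw [← Set.compl_empty_iff, ← Set.ncard_eq_zero]
        omega
      subst this
      exact ⟨n, bag, par, h, hn⟩
    | succ m ih =>
      intro n bag par U h hn hU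
      by_cases hUu : U = Set.univ
      · subst hUu
        exact ⟨n, bag, par, h, hn⟩
      · obtain ⟨v, hv⟩ := (Set.ne_univ_iff_exists_notMem U).mp hUu
        obtain ⟨bag', par', U', h', hU'⟩ := h.extend hsep hv
        refine ih _ _ _ _ h' (by omega) ?_
        have : U'ᶜ.ncard < Uᶜ.ncard := by
          refine Set.ncard_lt_ncard ⟨fun w hw hwU => hw (hU' (Or.inr hwU)), fun hss => ?_⟩
            (Set.toFinite _)
          exact hss hv (hU' (Or.inl rfl))
        omega
  have hstart : PartialDecomp G k 1 (fun _ => ∅) (fun _ => 0) ∅ := by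
    constructor
    · intro i hi h0
      exact h0
    · intro i hi j hj
      omega
    · simp
    · simp
    · simp
    · intro D _ _ _
      exact ⟨by simp, 0, by omega, by simp⟩
  obtain ⟨n, bag, par, h, hn⟩ := key _ 1 _ _ ∅ hstart one_pos le_rfl
  let td : TreeDecomp G :=
    { ι := Fin n
      tree := parentGraph n par
      isTree := isTree_parentGraph hn h.par_lt
      bag := fun i => bag i
      mem_bag := fun v => by
        obtain ⟨i, hi, hv⟩ := (h.mem_iff v).mp trivial
        exact ⟨⟨i, hi⟩, hv⟩
      adj_bag := fun u v huv => by
        obtain ⟨i, hi, h1, h2⟩ := h.adj_bag u trivial v trivial huv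
        exact ⟨⟨i, hi⟩, h1, h2⟩
      connected_bag := fun v => by
        refine connSet_parentGraph h.par_lt ?_ ?_
        · obtain ⟨i, hi, hv⟩ := (h.mem_iff v).mp trivial
          exact ⟨⟨i, hi⟩, hv⟩
        · intro i hi j hj hji
          have h0 := h.par_lt i i.2 (lt_of_le_of_lt (Nat.zero_le _) hji)
          exact ⟨⟨par i, h0.trans i.2⟩, h.running i i.2 j hji v hi hj, rfl⟩ }
  have hw : td.width ≤ 3 * k := by
    unfold TreeDecomp.width
    have : sSup {m | ∃ i, m = (td.bag i).card} ≤ 3 * k + 1 := by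
      refine csSup_le' ?_
      rintro m ⟨i, rfl⟩
      exact h.card_le i i.2
    omega
  have htw : treewidth G ≤ td.width := Nat.sInf_le ⟨td, rfl⟩
  exact htw.trans hw

/-- Large treewidth yields a family of pairwise intersecting connected sets that cannot be hit by
few vertices. -/
theorem exists_intersecting_family {V : Type} [Fintype V] (G : SimpleGraph V) (k : ℕ)
    (h : 3 * k < treewidth G) :
    ∃ ℬ : Set (Set V), (∀ X ∈ ℬ, ConnSet G X) ∧ (∀ X ∈ ℬ, ∀ Y ∈ ℬ, (X ∩ Y).Nonempty) ∧
      ∀ S : Finset V, S.card ≤ k → ∃ X ∈ ℬ, Disjoint X (S : Set V) := by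
  have hnot := mt (treewidth_le_of_balanced_separators G k) (by omega)
  push Not at hnot
  obtain ⟨W, hW, hZ⟩ := hnot
  refine ⟨{X | ConnSet G X ∧ k < (X ∩ W).ncard}, fun X hX => hX.1, ?_, ?_⟩
  · rintro X ⟨-, hX⟩ Y ⟨-, hY⟩
    by_contra hXY
    have hd : Disjoint (X ∩ W) (Y ∩ (W : Set V)) := by
      rw [Set.disjoint_left]
      exact fun w hw hw' => hXY ⟨w, hw.1, hw'.1⟩
    have h1 := Set.ncard_union_eq hd
    have h2 : ((X ∩ W) ∪ (Y ∩ (W : Set V))).ncard ≤ (W : Set V).ncard :=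
      Set.ncard_le_ncard (by rintro w (hw | hw) <;> exact hw.2) (Set.toFinite _)
    rw [Set.ncard_coe_finset] at h2
    omega
  · intro S hS
    obtain ⟨D, h1, h2, h3⟩ := hZ S hS
    exact ⟨D, ⟨h1, h3⟩, h2⟩

theorem isPath_append {V : Type*} {G : SimpleGraph V} {u v w : V} {p : G.Walk u v}
    {q : G.Walk v w} (hp : p.IsPath) (hq : q.IsPath)
    (h : ∀ x ∈ p.support, x ∈ q.support → x = v) : (p.append q).IsPath := by
  rw [Walk.isPath_def, Walk.support_append]
  have hq' := hq.support_nodup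
  rw [← Walk.cons_tail_support, List.nodup_cons] at hq'
  refine hp.support_nodup.append hq'.2 fun x hx hx' => ?_
  have := h x hx (by rw [← Walk.cons_tail_support]; exact List.mem_cons_of_mem _ hx')
  exact hq'.1 (this ▸ hx')

/-- In a finite graph some path meets every member of a family of pairwise intersecting connected
sets. -/
theorem exists_path_hitting {V : Type*} [Finite V] {G : SimpleGraph V} {ℬ : Set (Set V)}
    (hne : ℬ.Nonempty) (hconn : ∀ X ∈ ℬ, ConnSet G X)
    (hinter : ∀ X ∈ ℬ, ∀ Y ∈ ℬ, (X ∩ Y).Nonempty) :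
    ∃ (u v : V) (p : G.Walk u v), p.IsPath ∧ ∀ X ∈ ℬ, ∃ x ∈ p.support, x ∈ X := by
  classical
  have := Fintype.ofFinite V
  by_contra! hno
  have key : ∀ n : ℕ, ∃ (u v : V) (p : G.Walk u v), ∃ X ∈ ℬ, p.IsPath ∧ n ≤ p.length ∧ u ∈ X ∧
      ∀ w ∈ p.support, w ∈ X → w = u := by
    intro n
    induction n with
    | zero =>
      obtain ⟨X, hX⟩ := hne
      obtain ⟨x, hx⟩ := (hconn X hX).nonempty
      exact ⟨x, x, Walk.nil, X, hX, by simp, by simp, hx, by simp⟩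
    | succ n ih =>
      obtain ⟨u, v, p, X, hX, hp, hn, hu, honly⟩ := ih
      obtain ⟨Y, hY, hYp⟩ := hno u v p hp
      obtain ⟨R, z, huR, hRsub, hR, hzX, hzY, r, hr, hrz⟩ := (hconn X hX).exists_first_hit hu
        (hinter X hX Y hY) (hYp u p.start_mem_support)
      obtain ⟨q, hq, hqR⟩ := hR.exists_path hr huR
      have hqp : (q.append p).IsPath := isPath_append hq hp fun x hx hx' =>
        honly x hx' (hRsub (hqR x hx)).1
      have hsub : ∀ x ∈ (q.append p).support, x ∉ Y := by
        intro x hx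
        rw [Walk.mem_support_append_iff] at hx
        exact hx.elim (fun h => (hRsub (hqR x h)).2) (hYp x)
      refine ⟨z, v, Walk.cons hrz.symm (q.append p), Y, hY, ?_, ?_, hzY, ?_⟩
      · exact hqp.cons fun h => hsub z h hzY
      · rw [Walk.length_cons, Walk.length_append]
        omega
      · intro w hw hwY
        rw [Walk.support_cons, List.mem_cons] at hw
        exact hw.resolve_right fun h => hsub w h hwY
  obtain ⟨u, v, p, X, -, hp, hn, -⟩ := key (Fintype.card V)
  exact absurd hp.length_lt (by omega)

/-- The nonempty list `L` lists the vertices of a path. -/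
theorem exists_pathIn_of_list {V : Type} {G : SimpleGraph V} {L : List V} (hne : L ≠ [])
    (hc : L.IsChain G.Adj) (hn : L.Nodup) : ∃ P : PathIn G, P.verts = {v | v ∈ L} := by
  refine ⟨⟨_, _, Walk.ofSupport L hne hc, ?_⟩, ?_⟩
  · rw [Walk.isPath_def, Walk.support_ofSupport]
    exact hn
  · ext v
    simp [PathIn.verts]

/-- Splitting a list that meets all members of a family with large hitting number into pieces, each
of which meets all members of a subfamily with large hitting number. -/
theorem exists_split {V : Type*} {n : ℕ} (hn : 0 < n) (k : ℕ) :
    ∀ (L : List V) (ℬ : Set (Set V)), L.Nodup → (∀ X ∈ ℬ, ∃ x ∈ L, x ∈ X) →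
      (∀ S : Finset V, S.card < k * n → ∃ X ∈ ℬ, Disjoint X (S : Set V)) →
      ∃ (M : Fin k → List V) (𝒜 : Fin k → Set (Set V)),
        (∀ i, M i <:+: L) ∧ (Pairwise fun i j => (M i).Disjoint (M j)) ∧
        (∀ i, 𝒜 i ⊆ ℬ) ∧ (∀ i, ∀ X ∈ 𝒜 i, ∃ x ∈ M i, x ∈ X) ∧
        ∀ i, ∀ S : Finset V, S.card < n → ∃ X ∈ 𝒜 i, Disjoint X (S : Set V) := by
  classical
  induction k with
  | zero =>
    intro L ℬ _ _ _
    exact ⟨fun i => i.elim0, fun i => i.elim0, fun i => i.elim0, fun i => i.elim0,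
      fun i => i.elim0, fun i => i.elim0, fun i => i.elim0⟩
  | succ k ih =>
    intro L ℬ hL hhit hord
    let Good : ℕ → Prop := fun m => ∀ S : Finset V, S.card < n →
      ∃ X ∈ ℬ, (∃ x ∈ L.take m, x ∈ X) ∧ Disjoint X (S : Set V)
    have hgood : ∃ m, Good m := by
      refine ⟨L.length, fun S hS => ?_⟩
      obtain ⟨X, hX, hd⟩ := hord S (by nlinarith)
      exact ⟨X, hX, by simpa using hhit X hX, hd⟩
    have hspec := Nat.find_spec hgood
    have hmin := fun m => Nat.find_min hgood (m := m)
    set m := Nat.find hgood with hm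
    have hm0 : m ≠ 0 := by
      intro h0
      obtain ⟨X, -, ⟨x, hx, -⟩, -⟩ := hspec ∅ (by simpa using hn)
      rw [h0] at hx
      simp at hx
    obtain ⟨m', hm'⟩ := Nat.exists_eq_succ_of_ne_zero hm0
    have hbad := hmin m' (by omega)
    simp only [Good] at hbad
    push Not at hbad
    obtain ⟨S₀, hS₀, hhitS₀⟩ := hbad
    obtain ⟨S₁, hS₁, hhitS₁⟩ : ∃ S₁ : Finset V, S₁.card ≤ n ∧
        ∀ X ∈ ℬ, (∃ x ∈ L.take m, x ∈ X) → ¬ Disjoint X (S₁ : Set V) := by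
      by_cases hlt : m' < L.length
      · refine ⟨insert L[m'] S₀, (Finset.card_insert_le _ _).trans hS₀, ?_⟩
        rintro X hX ⟨x, hx, hxX⟩ hd
        rw [hm', Nat.succ_eq_add_one, List.take_add_one, List.mem_append,
          List.getElem?_eq_getElem hlt] at hx
        rw [Finset.coe_insert, Set.disjoint_insert_right] at hd
        rcases hx with hx | hx
        · exact hhitS₀ X hX ⟨x, hx, hxX⟩ hd.2
        · simp only [Option.toList_some, List.mem_singleton] at hx
          exact hd.1 (hx ▸ hxX)
      · refine ⟨S₀, hS₀.le, ?_⟩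
        rintro X hX ⟨x, hx, hxX⟩
        refine hhitS₀ X hX ⟨x, ?_, hxX⟩
        rw [List.take_of_length_le (by omega)]
        exact List.mem_of_mem_take hx
    obtain ⟨M, 𝒜, h1, h2, h3, h4, h5⟩ := ih (L.drop m) {X ∈ ℬ | ∀ x ∈ L.take m, x ∉ X}
      (hL.sublist (List.drop_sublist _ _))
      (by
        rintro X ⟨hX, hX'⟩
        obtain ⟨x, hx, hxX⟩ := hhit X hX
        rw [← List.take_append_drop m L, List.mem_append] at hx
        exact ⟨x, hx.resolve_left fun h => hX' x h hxX, hxX⟩)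
      (by
        intro S hS
        obtain ⟨X, hX, hd⟩ := hord (S ∪ S₁) (by
          have := Finset.card_union_le S S₁
          nlinarith)
        rw [Finset.coe_union, Set.disjoint_union_right] at hd
        refine ⟨X, ⟨hX, fun x hx hxX => ?_⟩, hd.1⟩
        exact hhitS₁ X hX ⟨x, hx, hxX⟩ hd.2)
    have hdisj : ∀ i, (L.take m).Disjoint (M i) := by
      intro i x hx hx'
      have hL' := hL
      rw [← List.take_append_drop m L, List.nodup_append'] at hL'
      exact hL'.2.2 hx ((h1 i).subset hx')
    refine ⟨Fin.cons (L.take m) M, Fin.cons {X ∈ ℬ | ∃ x ∈ L.take m, x ∈ X} 𝒜,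
      ?_, ?_, ?_, ?_, ?_⟩
    · refine Fin.cases ?_ fun i => ?_
      · exact ⟨[], L.drop m, by simp⟩
      · exact (h1 i).trans (List.drop_suffix m L).isInfix
    · intro i j hij
      induction i using Fin.cases with
      | zero =>
        induction j using Fin.cases with
        | zero => exact absurd rfl hij
        | succ j => exact hdisj j
      | succ i =>
        induction j using Fin.cases with
        | zero => exact (hdisj i).symm
        | succ j => exact h2 fun h => hij (congrArg Fin.succ h)
    · refine Fin.cases ?_ fun i => ?_
      · exact fun X hX => hX.1
      · exact (h3 i).trans fun X hX => hX.1
    · refine Fin.cases ?_ fun i => ?_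
      · exact fun X hX => hX.2
      · exact h4 i
    · refine Fin.cases ?_ fun i => ?_
      · intro S hS
        obtain ⟨X, hX, hX', hd⟩ := hspec S hS
        exact ⟨X, ⟨hX, hX'⟩, hd⟩
      · exact h5 i

/-- The linked paths that large treewidth provides: disjoint paths `P i`, any two of which are
joined by `n` disjoint paths. -/
theorem exists_linked_paths {V : Type} [Fintype V] (G : SimpleGraph V) {k n : ℕ}
    (hn : 0 < n) (h : 3 * (k * n) < treewidth G) :
    ∃ P : Fin k → PathIn G, (Pairwise fun i j => Disjoint (P i).verts (P j).verts) ∧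
      ∀ i j, ∃ Q : Fin n → PathIn G,
        (Pairwise fun a b => Disjoint (Q a).verts (Q b).verts) ∧
        ∀ a, (Q a).1 ∈ (P i).verts ∧ (Q a).2.1 ∈ (P j).verts := by
  classical
  obtain ⟨ℬ, hconn, hinter, hord⟩ := exists_intersecting_family G (k * n) h
  have hne : ℬ.Nonempty := by
    obtain ⟨X, hX, -⟩ := hord ∅ (by simp)
    exact ⟨X, hX⟩
  obtain ⟨u, v, p, hp, hhit⟩ := exists_path_hitting hne hconn hinter
  obtain ⟨M, 𝒜, h1, h2, h3, h4, h5⟩ := exists_split hn k p.support ℬ hp.support_nodup hhit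
    fun S hS => hord S hS.le
  have hM : ∀ i, ∃ P : PathIn G, P.verts = {v | v ∈ M i} := by
    intro i
    obtain ⟨s, t, hst⟩ := h1 i
    have hchain := p.isChain_adj_support
    rw [← hst, List.isChain_append, List.isChain_append] at hchain
    refine exists_pathIn_of_list ?_ hchain.1.2.1
      (hp.support_nodup.sublist (h1 i).sublist)
    obtain ⟨X, hX, -⟩ := h5 i ∅ (by simpa using hn)
    obtain ⟨x, hx, -⟩ := h4 i X hX
    exact List.ne_nil_of_mem hx
  choose P hP using hM
  refine ⟨P, fun i j hij => ?_, fun i j => ?_⟩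
  · simp only [hP]
    exact Set.disjoint_left.mpr fun x hx hx' => h2 hij hx hx'
  · obtain ⟨Q, hQ, hQc, hQi, hQj⟩ := menger n _ G le_rfl (P i).verts (P j).verts (by
      intro S hS
      by_contra! hlt
      obtain ⟨X, hX, hXS⟩ := h5 i S hlt
      obtain ⟨Y, hY, hYS⟩ := h5 j S hlt
      obtain ⟨x, hx, hxX⟩ := h4 i X hX
      obtain ⟨y, hy, hyY⟩ := h4 j Y hY
      have hXY := (hconn X (h3 i hX)).union (hconn Y (h3 j hY)) (hinter X (h3 i hX) Y (h3 j hY))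
      have := hS (X ∪ Y) hXY ⟨x, Or.inl hxX, by rw [hP]; exact hx⟩
        ⟨y, Or.inr hyY, by rw [hP]; exact hy⟩
      obtain ⟨z, hz, hzS⟩ := this
      exact hz.elim (fun h => Set.disjoint_left.mp hXS h hzS)
        fun h => Set.disjoint_left.mp hYS h hzS)
    choose a ha haP using hQi
    choose b hb hbP using hQj
    choose q hq hqQ using fun m => (hQc m).exists_path (ha m) (hb m)
    refine ⟨fun m => ⟨a m, b m, q m, hq m⟩, fun m m' hmm => ?_, fun m => ⟨haP m, hbP m⟩⟩
    exact (hQ hmm).mono (fun x hx => hqQ m x hx) fun x hx => hqQ m' x hx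

/-- Resampling two coordinates outside `T` of functions avoiding conflicts on `T`. -/
theorem card_conflict_le {E F : Type*} [Fintype E] [Fintype F] [DecidableEq E] [DecidableEq F]
    (p : (E → F) → Prop) [DecidablePred p] (c : F → F → Prop) [DecidableRel c] {i j : E}
    (hij : i ≠ j) (hpi : ∀ f a, p f → p (Function.update f i a))
    (hpj : ∀ f a, p f → p (Function.update f j a)) :
    Fintype.card F ^ 2 * (Finset.univ.filter fun f : E → F => p f ∧ c (f i) (f j)).card ≤
      (Finset.univ.filter fun x : F × F => c x.1 x.2).card *
        (Finset.univ.filter fun f : E → F => p f).card := by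
  rw [sq, ← Fintype.card_prod, ← Finset.card_univ, ← Finset.card_product, ← Finset.card_product]
  refine Finset.card_le_card_of_injOn
    (fun x => ((x.2 i, x.2 j), Function.update (Function.update x.2 i x.1.1) j x.1.2)) ?_ ?_
  · rintro ⟨⟨a, b⟩, f⟩ h
    simp only [Finset.coe_product, Finset.coe_univ, Set.mem_prod, Set.mem_univ, true_and,
      Finset.coe_filter, Finset.mem_univ, Set.mem_ofPred_eq] at h ⊢
    exact ⟨h.2, hpj _ _ (hpi _ _ h.1)⟩
  · rintro ⟨⟨a, b⟩, f⟩ - ⟨⟨a', b'⟩, f'⟩ - h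
    simp only [Prod.mk.injEq] at h
    obtain ⟨⟨h1, h2⟩, h3⟩ := h
    have hi := congrFun h3 i
    have hj := congrFun h3 j
    simp only [Function.update_of_ne hij, Function.update_self] at hi hj
    have hf : f = f' := by
      funext e
      rcases eq_or_ne e i with rfl | hei
      · exact h1
      · rcases eq_or_ne e j with rfl | hej
        · exact h2
        · simpa [Function.update_of_ne hei, Function.update_of_ne hej] using congrFun h3 e
    rw [hi, hj, hf]

/-- Independent transversals exist when conflicts between classes are sparse. -/
theorem exists_transversal {E F : Type*} [Fintype E] [Fintype F] [Nonempty F]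
    (c : E → E → F → F → Prop) (hsymm : ∀ e e' a b, c e e' a b → c e' e b a) (K : ℕ)
    (hK : ∀ e e', e ≠ e' → {x : F × F | c e e' x.1 x.2}.ncard ≤ K)
    (hcard : 4 * Fintype.card E * K ≤ Fintype.card F ^ 2) :
    ∃ f : E → F, ∀ e e', e ≠ e' → ¬ c e e' (f e) (f e') := by
  classical
  let good : Finset E → (E → F) → Prop := fun S f =>
    ∀ e ∈ S, ∀ e' ∈ S, e ≠ e' → ¬ c e e' (f e) (f e')
  let N : Finset E → ℕ := fun S => (Finset.univ.filter fun f : E → F => good S f).card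
  have hF : 0 < Fintype.card F ^ 2 := by positivity
  have hgood : ∀ (S : Finset E) (i : E), i ∉ S → ∀ (f : E → F) (a : F), good S f →
      good S (Function.update f i a) := by
    intro S i hi f a hf e he e' he' hne
    rw [Function.update_of_ne (ne_of_mem_of_not_mem he hi),
      Function.update_of_ne (ne_of_mem_of_not_mem he' hi)]
    exact hf e he e' he' hne
  have key : ∀ S : Finset E, ∀ i ∉ S, N S ≤ 2 * N (insert i S) := by
    intro S
    induction S using Finset.strongInduction with
    | H S ih =>
      intro i hi
      have h1 : N S ≤ N (insert i S) + ∑ j ∈ S, (Finset.univ.filter fun f : E → F =>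
          good (S.erase j) f ∧ c i j (f i) (f j)).card := by
        refine le_trans (Finset.card_le_card (t := (Finset.univ.filter fun f : E → F =>
          good (insert i S) f) ∪ S.biUnion fun j => Finset.univ.filter fun f : E → F =>
          good (S.erase j) f ∧ c i j (f i) (f j)) ?_) ((Finset.card_union_le _ _).trans
            (Nat.add_le_add_left Finset.card_biUnion_le _))
        intro f hf
        rw [Finset.mem_filter] at hf
        by_cases hex : ∃ j ∈ S, c i j (f i) (f j)
        · obtain ⟨j, hj, hcj⟩ := hex
          refine Finset.mem_union_right _ (Finset.mem_biUnion.mpr ⟨j, hj, ?_⟩)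
          exact Finset.mem_filter.mpr ⟨Finset.mem_univ _, fun e he e' he' =>
            hf.2 e (Finset.mem_of_mem_erase he) e' (Finset.mem_of_mem_erase he'), hcj⟩
        · push Not at hex
          refine Finset.mem_union_left _ (Finset.mem_filter.mpr ⟨Finset.mem_univ _, ?_⟩)
          intro e he e' he' hne hc
          rcases Finset.mem_insert.mp he with rfl | hS
          · rcases Finset.mem_insert.mp he' with rfl | hS'
            · exact hne rfl
            · exact hex e' hS' hc
          · rcases Finset.mem_insert.mp he' with rfl | hS'
            · exact hex e hS (hsymm _ _ _ _ hc)
            · exact hf.2 e hS e' hS' hne hc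
      have h2 : ∀ j ∈ S, Fintype.card F ^ 2 * (Finset.univ.filter fun f : E → F =>
          good (S.erase j) f ∧ c i j (f i) (f j)).card ≤ K * (2 * N S) := by
        intro j hj
        have hij : i ≠ j := fun h => hi (h ▸ hj)
        refine (card_conflict_le (good (S.erase j)) (c i j) hij
          (hgood _ _ fun h => hi (Finset.mem_of_mem_erase h))
          (hgood _ _ (Finset.notMem_erase j S))).trans (Nat.mul_le_mul ?_ ?_)
        · rw [← Set.ncard_coe_finset]
          simpa using hK i j hij
        · have := ih (S.erase j) (Finset.erase_ssubset hj) j (Finset.notMem_erase j S)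
          rwa [Finset.insert_erase hj] at this
      have h3 : Fintype.card F ^ 2 * N S ≤ Fintype.card F ^ 2 * N (insert i S) +
          Fintype.card E * (K * (2 * N S)) := by
        calc Fintype.card F ^ 2 * N S ≤ Fintype.card F ^ 2 * (N (insert i S) + _) :=
              Nat.mul_le_mul_left _ h1
          _ ≤ _ := by
            rw [mul_add, Finset.mul_sum]
            refine Nat.add_le_add_left ((Finset.sum_le_card_nsmul _ _ _ h2).trans ?_) _
            rw [smul_eq_mul]
            exact Nat.mul_le_mul_right _ (Finset.card_le_univ S)
      have h4 := Nat.mul_le_mul_right (N S) hcard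
      refine Nat.le_of_mul_le_mul_left ?_ hF
      nlinarith
  have hpos : ∀ S : Finset E, 0 < N S := by
    intro S
    induction S using Finset.induction_on with
    | empty => exact Finset.card_pos.mpr ⟨fun _ => Classical.arbitrary F, by simp [good]⟩
    | insert i S hi ih =>
      have := key S i hi
      omega
  obtain ⟨f, hf⟩ := Finset.card_pos.mp (hpos Finset.univ)
  exact ⟨f, fun e e' => (Finset.mem_filter.mp hf).2 e (Finset.mem_univ e) e' (Finset.mem_univ e')⟩

theorem exists_walk_transfer {V W : Type*} {H : SimpleGraph V} {G : SimpleGraph W} (f : V → W)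
    {S : Set V} {T : Set W} (hf : ∀ u ∈ S, f u ∈ T)
    (h : ∀ u ∈ S, ∀ v ∈ S, H.Adj u v → ∃ p : G.Walk (f u) (f v), ∀ w ∈ p.support, w ∈ T)
    {u v : V} (p : H.Walk u v) (hp : ∀ w ∈ p.support, w ∈ S) :
    ∃ q : G.Walk (f u) (f v), ∀ w ∈ q.support, w ∈ T := by
  induction p with
  | nil => exact ⟨Walk.nil, by simpa using hf _ (hp _ (by simp))⟩
  | cons hadj p ih =>
    simp only [Walk.support_cons, List.mem_cons, forall_eq_or_imp] at hp
    obtain ⟨q, hq⟩ := ih hp.2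
    obtain ⟨r, hr⟩ := h _ hp.1 _ (hp.2 _ p.start_mem_support) hadj
    refine ⟨r.append q, fun w hw => ?_⟩
    rw [Walk.mem_support_append_iff] at hw
    exact hw.elim (hr w) (hq w)

theorem MinorOf.of_hom {α V W : Type*} {K : SimpleGraph α} {H : SimpleGraph V} {G : SimpleGraph W}
    (h : MinorOf K H) (f : H →g G) (hf : Function.Injective f) : MinorOf K G := by
  obtain ⟨B, hdisj, hconn, hadj⟩ := h
  refine ⟨fun a => f '' B a, fun a b hab => Set.disjoint_image_of_injective hf (hdisj hab),
    fun a => ?_, fun a b hab => ?_⟩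
  · refine connSet_iff.mpr ⟨(ConnSet.nonempty (hconn a)).image f, ?_⟩
    rintro _ ⟨u, hu, rfl⟩ _ ⟨v, hv, rfl⟩
    obtain ⟨p, hp⟩ := ConnSet.exists_walk (hconn a) hu hv
    exact exists_walk_transfer f (T := f '' B a) (fun u hu => Set.mem_image_of_mem f hu)
      (fun u hu v hv huv => ⟨(f.map_adj huv).toWalk, by
        simp [Set.mem_image_of_mem f hu, Set.mem_image_of_mem f hv, -Set.mem_image]⟩) p hp
  · obtain ⟨u, hu, v, hv, huv⟩ := hadj a b hab
    exact ⟨f u, ⟨u, hu, rfl⟩, f v, ⟨v, hv, rfl⟩, f.map_adj huv⟩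

/-- The contraction of `y` into `x`, on the same vertex set, leaving `y` isolated. -/
def contractInto {V : Type*} (G : SimpleGraph V) (x y : V) : SimpleGraph V where
  Adj a b := a ≠ b ∧ a ≠ y ∧ b ≠ y ∧
    (G.Adj a b ∨ (a = x ∧ G.Adj y b) ∨ (b = x ∧ G.Adj y a))
  symm := ⟨fun a b ⟨h1, h2, h3, h4⟩ => ⟨h1.symm, h3, h2, by
    rcases h4 with h | h | h
    · exact Or.inl h.symm
    · exact Or.inr (Or.inr h)
    · exact Or.inr (Or.inl h)⟩⟩
  loopless := ⟨fun a h => h.1 rfl⟩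

theorem minorOf_of_contractInto {V : Type*} {G : SimpleGraph V} {x y : V} (hxy : G.Adj x y)
    {t : ℕ} (ht : 2 ≤ t) (h : MinorOf (completeGraph (Fin t)) (contractInto G x y)) :
    MinorOf (completeGraph (Fin t)) G := by
  classical
  obtain ⟨B, hdisj, hconn, hadj⟩ := h
  have hy : ∀ a, y ∉ B a := by
    intro a hya
    obtain ⟨b, hb⟩ : ∃ b : Fin t, a ≠ b := by
      have : Nontrivial (Fin t) := Fin.nontrivial_iff_two_le.mpr ht
      obtain ⟨b, hb⟩ := exists_ne a
      exact ⟨b, hb.symm⟩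
    obtain ⟨u, hu, v, -, huv⟩ := hadj a b hb
    obtain ⟨z, w, -, rfl, -, -, hzw⟩ := ConnSet.exists_boundary (R := {y}) (hconn a) hya rfl hu
      (by rintro rfl; exact huv.2.1 rfl)
    exact hzw.2.1 rfl
  let B' : Fin t → Set V := fun a => if x ∈ B a then insert y (B a) else B a
  have hsub : ∀ a, B a ⊆ B' a := by
    intro a
    simp only [B']
    split_ifs
    · exact Set.subset_insert _ _
    · exact subset_rfl
  have hmem : ∀ a u, u ∈ B' a → u ∈ B a ∨ (u = y ∧ x ∈ B a) := by
    intro a u hu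
    simp only [B'] at hu
    split_ifs at hu with hx
    · exact hu.symm.imp id fun h => ⟨h, hx⟩
    · exact Or.inl hu
  have hyB : ∀ a, x ∈ B a → y ∈ B' a := by
    intro a hx
    simp [B', hx]
  have hstep : ∀ a, ∀ u ∈ B a, ∀ v ∈ B a, (contractInto G x y).Adj u v →
      ∃ p : G.Walk u v, ∀ w ∈ p.support, w ∈ B' a := by
    rintro a u hu v hv ⟨-, -, -, h | ⟨rfl, h⟩ | ⟨rfl, h⟩⟩
    · exact ⟨h.toWalk, by simp [hsub a hu, hsub a hv]⟩
    · exact ⟨Walk.cons hxy h.toWalk, by simp [hsub a hu, hsub a hv, hyB a hu]⟩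
    · exact ⟨Walk.cons h.symm hxy.symm.toWalk, by simp [hsub a hu, hsub a hv, hyB a hv]⟩
  refine ⟨B', fun a b hab => Set.disjoint_left.mpr fun u hu hu' => ?_, fun a => ?_,
    fun a b hab => ?_⟩
  · have hd := Set.disjoint_left.mp (hdisj hab)
    rcases hmem a u hu with h | ⟨h, hx⟩ <;> rcases hmem b u hu' with h' | ⟨h', hx'⟩
    · exact hd h h'
    · exact hy a (h' ▸ h)
    · exact hy b (h ▸ h')
    · exact hd hx hx'
  · obtain ⟨c, hc⟩ := ConnSet.nonempty (hconn a)
    refine connSet_of_center (hsub a hc) fun u hu => ?_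
    have hwalk : ∀ u ∈ B a, ∃ p : G.Walk c u, ∀ w ∈ p.support, w ∈ B' a := by
      intro u hu
      obtain ⟨p, hp⟩ := ConnSet.exists_walk (hconn a) hc hu
      exact exists_walk_transfer id (fun u hu => hsub a hu) (hstep a) p hp
    rcases hmem a u hu with h | ⟨rfl, hx⟩
    · exact hwalk u h
    · obtain ⟨p, hp⟩ := hwalk x hx
      refine ⟨p.concat hxy, fun w hw => ?_⟩
      rw [Walk.support_concat, List.mem_append, List.mem_singleton] at hw
      rcases hw with hw | rfl
      · exact hp w hw
      · exact hyB a hx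
  · obtain ⟨u, hu, v, hv, -, -, -, h | ⟨rfl, h⟩ | ⟨rfl, h⟩⟩ := hadj a b hab
    · exact ⟨u, hsub a hu, v, hsub b hv, h⟩
    · exact ⟨y, hyB a hu, v, hsub b hv, h⟩
    · exact ⟨u, hsub a hu, y, hyB b hv, h.symm⟩

theorem ncard_edgeSet_contractInto {V : Type*} [Finite V] {G : SimpleGraph V} {x y : V}
    (hxy : G.Adj x y) {d : ℕ} (h : (G.neighborSet x ∩ G.neighborSet y).ncard < d) :
    G.edgeSet.ncard ≤ (contractInto G x y).edgeSet.ncard + d := by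
  classical
  have := Fintype.ofFinite V
  have hsplit : G.edgeSet ⊆ ({e ∈ (contractInto G x y).edgeSet | e ∈ G.edgeSet} ∪
      (fun z => s(y, z)) '' (G.neighborSet y \ insert x (G.neighborSet x))) ∪
      ((fun z => s(y, z)) '' (G.neighborSet x ∩ G.neighborSet y) ∪ {s(x, y)}) := by
    intro e he
    induction e using Sym2.ind with
    | h a b =>
      rw [mem_edgeSet] at he
      have hyz : ∀ z, G.Adj y z → s(y, z) ∈ ({e ∈ (contractInto G x y).edgeSet | e ∈ G.edgeSet} ∪
          (fun z => s(y, z)) '' (G.neighborSet y \ insert x (G.neighborSet x))) ∪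
          ((fun z => s(y, z)) '' (G.neighborSet x ∩ G.neighborSet y) ∪ {s(x, y)}) := by
        intro z hz
        by_cases hzx : z = x
        · subst hzx
          exact Or.inr (Or.inr Sym2.eq_swap)
        · by_cases hxz : G.Adj x z
          · exact Or.inr (Or.inl ⟨z, ⟨hxz, hz⟩, rfl⟩)
          · refine Or.inl (Or.inr ⟨z, ⟨hz, ?_⟩, rfl⟩)
            rintro (h | h)
            · exact hzx h
            · exact hxz h
      by_cases ha : a = y
      · subst ha
        exact hyz b he
      · by_cases hb : b = y
        · subst hb
          exact (Sym2.eq_swap : s(a, b) = s(b, a)) ▸ hyz a he.symm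
        · exact Or.inl (Or.inl ⟨⟨he.ne, ha, hb, Or.inl he⟩, he⟩)
  have hinj : ∀ z : V, Function.Injective fun w => s(z, w) := fun z w w' h =>
    Sym2.congr_right.mp h
  have h1 : ({e ∈ (contractInto G x y).edgeSet | e ∈ G.edgeSet}).ncard +
      ((fun z => s(x, z)) '' (G.neighborSet y \ insert x (G.neighborSet x))).ncard ≤
      (contractInto G x y).edgeSet.ncard := by
    rw [← Set.ncard_union_eq _ (Set.toFinite _) (Set.toFinite _)]
    · refine Set.ncard_le_ncard ?_ (Set.toFinite _)
      rintro e (he | ⟨z, ⟨hz, hzx⟩, rfl⟩)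
      · exact he.1
      · exact ⟨fun h => hzx (Or.inl h.symm), hxy.ne, hz.ne',
          Or.inr (Or.inl ⟨rfl, hz⟩)⟩
    · refine Set.disjoint_left.mpr ?_
      rintro _ ⟨-, he⟩ ⟨z, ⟨-, hz⟩, rfl⟩
      exact hz (Or.inr he)
  rw [Set.ncard_image_of_injective _ (hinj x)] at h1
  have h2 := Set.ncard_le_ncard hsplit (Set.toFinite _)
  refine h2.trans ((Set.ncard_union_le _ _).trans ((Nat.add_le_add (Set.ncard_union_le _ _)
    (Set.ncard_union_le _ _)).trans ?_))
  rw [Set.ncard_image_of_injective _ (hinj y), Set.ncard_image_of_injective _ (hinj y),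
    Set.ncard_singleton]
  omega

theorem exists_mem_support_ncard_le {V : Type*} [Finite V] (G : SimpleGraph V) {d : ℕ}
    (hne : G.support.Nonempty) (h : G.edgeSet.ncard ≤ d * G.support.ncard) :
    ∃ v ∈ G.support, (G.neighborSet v).ncard ≤ 2 * d := by
  classical
  have := Fintype.ofFinite V
  by_contra! hlt
  have hsum := G.sum_degrees_eq_twice_card_edges
  have h1 : G.support.toFinset.card • (2 * d + 1) ≤ ∑ v ∈ G.support.toFinset, G.degree v := by
    refine Finset.card_nsmul_le_sum _ _ _ fun v hv => ?_
    have := hlt v (Set.mem_toFinset.mp hv)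
    rwa [Set.ncard_eq_toFinset_card', Set.toFinset_card, card_neighborSet_eq_degree] at this
  have h2 : ∑ v ∈ G.support.toFinset, G.degree v ≤ ∑ v, G.degree v :=
    Finset.sum_le_sum_of_subset (Finset.subset_univ _)
  rw [← Set.ncard_eq_toFinset_card', smul_eq_mul] at h1
  have h3 : G.edgeSet.ncard = G.edgeFinset.card := Set.ncard_eq_toFinset_card' _
  have h4 : 0 < G.support.ncard := (Set.ncard_pos (Set.toFinite _)).mpr hne
  nlinarith

/-- Reduction of the existence of a complete minor in graphs of large average degree to small
graphs of large minimum degree. -/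
theorem minorOf_of_small_dense.{u} {t d : ℕ} (ht : 2 ≤ t) (hd : 1 ≤ d)
    (hsmall : ∀ (W : Type u) [Fintype W] [Nonempty W] (H : SimpleGraph W),
      Fintype.card W ≤ 2 * d → (∀ w, d ≤ (H.neighborSet w).ncard) →
      MinorOf (completeGraph (Fin t)) H) {V : Type u} [Finite V] (a : ℕ) :
    ∀ (b : ℕ) (G : SimpleGraph V), G.support.ncard ≤ a → G.edgeSet.ncard ≤ b →
      G.edgeSet.Nonempty → d * G.support.ncard ≤ G.edgeSet.ncard →
      MinorOf (completeGraph (Fin t)) G := by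
  have hfin : ∀ s : Set V, s.Finite := fun s => Set.toFinite s
  have hfin' : ∀ s : Set (Sym2 V), s.Finite := fun s => Set.toFinite s
  have hsupp : ∀ G : SimpleGraph V, G.edgeSet.Nonempty →
      ∃ x y, G.Adj x y ∧ 2 ≤ G.support.ncard := by
    rintro G ⟨e, he⟩
    induction e using Sym2.ind with
    | h x y =>
      have hxy : G.Adj x y := he
      refine ⟨x, y, hxy, ?_⟩
      rw [← Set.ncard_pair hxy.ne]
      refine Set.ncard_le_ncard ?_ (hfin _)
      rintro z (rfl | rfl)
      · exact ⟨y, hxy⟩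
      · exact ⟨x, hxy.symm⟩
  induction a with
  | zero =>
    intro b G h1 h2 h3 h4
    obtain ⟨x, y, -, h⟩ := hsupp G h3
    omega
  | succ a iha =>
    intro b
    induction b with
    | zero =>
      intro G h1 h2 h3 h4
      have := (Set.ncard_pos (hfin' _)).mpr h3
      omega
    | succ b ihb =>
      intro G h1 h2 h3 h4
      obtain ⟨x₀, y₀, hxy₀, hs2⟩ := hsupp G h3
      rcases lt_or_eq_of_le h4 with hlt | heq
      · let G' := G.deleteEdges {s(x₀, y₀)}
        have hle : G' ≤ G := deleteEdges_le _
        have he : G'.edgeSet.ncard + 1 = G.edgeSet.ncard := by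
          have : G'.edgeSet = G.edgeSet \ {s(x₀, y₀)} := edgeSet_deleteEdges _
          rw [this]
          exact Set.ncard_sdiff_singleton_add_one hxy₀ (hfin' _)
        have hs : G'.support.ncard ≤ G.support.ncard :=
          Set.ncard_le_ncard (support_mono hle) (hfin _)
        have hmul : d * G'.support.ncard ≤ d * G.support.ncard := Nat.mul_le_mul_left _ hs
        refine (ihb G' (by omega) (by omega) ?_ (by omega)).of_hom (Hom.ofLE hle)
          Function.injective_id
        rw [← Set.ncard_pos (hfin' _)]
        nlinarith
      · by_cases hex : ∃ x y, G.Adj x y ∧ (G.neighborSet x ∩ G.neighborSet y).ncard < d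
        · obtain ⟨x, y, hxy, hcom⟩ := hex
          have he := ncard_edgeSet_contractInto hxy hcom
          have hs : (contractInto G x y).support.ncard + 1 ≤ G.support.ncard := by
            have hy : y ∈ G.support := ⟨x, hxy.symm⟩
            rw [← Set.ncard_sdiff_singleton_add_one hy (hfin _)]
            refine Nat.add_le_add_right (Set.ncard_le_ncard ?_ (hfin _)) 1
            rintro z ⟨w, -, hz, hw, h⟩
            refine ⟨?_, hz⟩
            rcases h with h | ⟨rfl, -⟩ | ⟨rfl, h⟩
            · exact ⟨w, h⟩
            · exact ⟨y, hxy⟩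
            · exact ⟨y, h.symm⟩
          have hmul : d * (contractInto G x y).support.ncard + d ≤ d * G.support.ncard := by
            rw [← Nat.mul_succ]
            exact Nat.mul_le_mul_left _ hs
          refine minorOf_of_contractInto hxy ht (iha _ _ (by omega) le_rfl ?_ (by omega))
          rw [← Set.ncard_pos (hfin' _)]
          nlinarith
        · push Not at hex
          obtain ⟨v, ⟨w, hvw⟩, hv⟩ := exists_mem_support_ncard_le G (d := d) ⟨x₀, y₀, hxy₀⟩ heq.ge
          have : Nonempty (G.neighborSet v) := ⟨⟨w, hvw⟩⟩
          have := Fintype.ofFinite (G.neighborSet v)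
          have hm := hsmall (G.neighborSet v) (G.induce (G.neighborSet v))
            (by rwa [← Nat.card_eq_fintype_card]) (fun u => by
              refine (hex v u u.2).trans ?_
              rw [← Set.ncard_image_of_injective _ Subtype.val_injective]
              refine Set.ncard_le_ncard ?_ (hfin _)
              rintro z ⟨hz, hz'⟩
              exact ⟨⟨z, hz⟩, hz', rfl⟩)
          exact hm.of_hom (Embedding.induce _).toHom Subtype.val_injective

open Classical in
/-- If every `i ∈ I` is related to a `p`-fraction of `J`, then some `s` elements of `J` leave at
most a `(1 - p) ^ s`-fraction of `I` unrelated. -/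
theorem exists_cover {α β : Type*} (I : Finset α) {J : Finset β} (hJ : J.Nonempty)
    (r : α → β → Prop) {p : ℝ} (hp : p ≤ 1)
    (h : ∀ i ∈ I, p * (J.card : ℝ) ≤ ((J.filter (r i)).card : ℝ)) (s : ℕ) :
    ∃ S ⊆ J, S.card ≤ s ∧ ∃ I' ⊆ I, (∀ i ∈ I, (∀ j ∈ S, ¬ r i j) → i ∈ I') ∧
      (I'.card : ℝ) ≤ (1 - p) ^ s * (I.card : ℝ) := by
  induction s with
  | zero => exact ⟨∅, by simp, by simp, I, subset_rfl, fun i hi _ => hi, by simp⟩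
  | succ s ih =>
    obtain ⟨S, hS, hSs, I', hI'I, hI', hcov⟩ := ih
    have hsum : ∑ j ∈ J, ((I'.filter fun i => ¬ r i j).card : ℝ) ≤
        ∑ _j ∈ J, (1 - p) * (I'.card : ℝ) := by
      have hswap := Finset.sum_card_bipartiteAbove_eq_sum_card_bipartiteBelow
        (s := I') (t := J) (fun i j => ¬ r i j)
      simp only [Finset.bipartiteAbove, Finset.bipartiteBelow] at hswap
      rw [← Nat.cast_sum, ← hswap, Nat.cast_sum, Finset.sum_const, nsmul_eq_mul]
      calc ∑ i ∈ I', ((J.filter fun j => ¬ r i j).card : ℝ)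
          ≤ ∑ _i ∈ I', (1 - p) * (J.card : ℝ) := by
            refine Finset.sum_le_sum fun i hi => ?_
            have h1 := h i (hI'I hi)
            have h2 : ((J.filter (r i)).card : ℝ) + ((J.filter fun j => ¬ r i j).card : ℝ) =
                (J.card : ℝ) := by
              exact_mod_cast Finset.card_filter_add_card_filter_not (s := J) (r i)
            linarith
        _ = (J.card : ℝ) * ((1 - p) * (I'.card : ℝ)) := by
            rw [Finset.sum_const, nsmul_eq_mul]
            ring
    obtain ⟨j, hj, hle⟩ := Finset.exists_le_of_sum_le hJ hsum
    refine ⟨insert j S, Finset.insert_subset hj hS, (Finset.card_insert_le _ _).trans (by omega),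
      I'.filter fun i => ¬ r i j, (Finset.filter_subset _ _).trans hI'I, fun i hi hni => ?_, ?_⟩
    · rw [Finset.forall_mem_insert] at hni
      exact Finset.mem_filter.mpr ⟨hI' i hi hni.2, hni.1⟩
    · calc _ ≤ (1 - p) * (I'.card : ℝ) := hle
        _ ≤ (1 - p) * ((1 - p) ^ s * (I.card : ℝ)) :=
            mul_le_mul_of_nonneg_left hcov (by linarith)
        _ = _ := by ring

open Classical in
/-- Greedy construction of a complete minor in a graph with two sets `X` and `Y` such that `X` has
many neighbors in `Y`, and `X ∪ Y` is robustly connected by short walks. -/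
theorem minorOf_of_robust {V : Type*} [Fintype V] (H : SimpleGraph V) (X Y : Finset V)
    {s t : ℕ} (hs : 1 ≤ s) (hN : 704 * s * t ≤ Fintype.card V)
    (hX : Fintype.card V ≤ 32 * X.card)
    (hXY : ∀ x ∈ X, Fintype.card V ≤ 32 * (Y.filter (H.Adj x)).card)
    (hwalk : ∀ Z : Finset V, 64 * Z.card ≤ Fintype.card V → ∀ u ∈ X ∪ Y, ∀ w ∈ X ∪ Y,
      u ∉ Z → w ∉ Z → ∃ p : H.Walk u w, p.length ≤ 4 ∧ ∀ v ∈ p.support, v ∉ Z)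
    (hst : (t : ℝ) * (2 * (63 / 64 : ℝ) ^ s) ^ s < 1) :
    MinorOf (completeGraph (Fin t)) H := by
  set N := Fintype.card V with hNdef
  set δ : ℝ := (63 / 64 : ℝ) ^ s with hδ
  have key : ∀ j ≤ t, ∃ K : Fin j → Finset V,
      (Pairwise fun a b => Disjoint (K a) (K b)) ∧ (∀ a, ConnSet H (K a : Set V)) ∧
      (∀ a, (K a).card ≤ 11 * s) ∧
      (∀ a, ((X.filter fun x => ∀ k ∈ K a, ¬ H.Adj x k).card : ℝ) ≤ δ * (X.card : ℝ)) ∧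
      ∀ a b, a ≠ b → ∃ u ∈ K a, ∃ v ∈ K b, H.Adj u v := by
    intro j
    induction j with
    | zero =>
      intro _
      exact ⟨fun a => a.elim0, fun a => a.elim0, fun a => a.elim0, fun a => a.elim0,
        fun a => a.elim0, fun a => a.elim0⟩
    | succ j ih =>
      intro hjt
      obtain ⟨K, hdisj, hconn, hcard, hdom, hadj⟩ := ih (by omega)
      set Z := Finset.univ.biUnion K with hZ
      have hZcard : 64 * Z.card ≤ N := by
        have h1 : Z.card ≤ j * (11 * s) := by
          refine (Finset.card_biUnion_le).trans ((Finset.sum_le_card_nsmul _ _ _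
            fun a _ => hcard a).trans ?_)
          simp
        nlinarith
      have hNpos : 0 < N := by nlinarith
      have hX' : X.card ≤ 2 * (X \ Z).card := by
        have := Finset.le_card_sdiff Z X
        omega
      have hXne : (X \ Z).Nonempty := by
        rw [← Finset.card_pos]
        omega
      obtain ⟨x₀, hx₀⟩ := hXne
      have hYx : ∀ x ∈ X, N ≤ 64 * ((Y \ Z).filter (H.Adj x)).card := by
        intro x hx
        have h1 := hXY x hx
        have h2 := Finset.le_card_sdiff Z (Y.filter (H.Adj x))
        have h3 : Y.filter (H.Adj x) \ Z ⊆ (Y \ Z).filter (H.Adj x) := by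
          intro v hv
          simp only [Finset.mem_sdiff, Finset.mem_filter] at hv ⊢
          tauto
        have h4 := Finset.card_le_card h3
        omega
      have hYne : (Y \ Z).Nonempty := by
        have h1 := hYx x₀ (Finset.mem_sdiff.mp hx₀).1
        have h2 := Finset.card_le_card (Finset.filter_subset (H.Adj x₀) (Y \ Z))
        rw [← Finset.card_pos]
        omega
      obtain ⟨A, hA, hAs, I₁, -, hI₁, hAcov⟩ := exists_cover (Finset.univ : Finset (Fin j)) ⟨x₀, hx₀⟩
        (fun a x => ∃ k ∈ K a, H.Adj x k) (p := 1 - 2 * δ)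
        (by
          have : 0 ≤ δ := by positivity
          linarith)
        (fun a _ => by
          have h1 := hdom a
          have h2 := Finset.card_filter_add_card_filter_not (s := X \ Z)
            (fun x => ∃ k ∈ K a, H.Adj x k)
          have h3 : ((X \ Z).filter fun x => ¬ ∃ k ∈ K a, H.Adj x k) ⊆
              X.filter fun x => ∀ k ∈ K a, ¬ H.Adj x k := by
            intro v hv
            simp only [Finset.mem_sdiff, Finset.mem_filter, not_exists, not_and] at hv ⊢
            exact ⟨hv.1.1, hv.2⟩
          have h4 : (((X \ Z).filter fun x => ¬ ∃ k ∈ K a, H.Adj x k).card : ℝ) ≤ _ :=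
            Nat.cast_le.mpr (Finset.card_le_card h3)
          have h5 : (X.card : ℝ) ≤ 2 * ((X \ Z).card : ℝ) := by exact_mod_cast hX'
          have h6 : 0 ≤ δ := by positivity
          have h7 : (((X \ Z).filter fun x => ∃ k ∈ K a, H.Adj x k).card : ℝ) +
            (((X \ Z).filter fun x => ¬ ∃ k ∈ K a, H.Adj x k).card : ℝ) =
            ((X \ Z).card : ℝ) := by exact_mod_cast h2
          have h8 := mul_le_mul_of_nonneg_left h5 h6
          have h9 : (1 - 2 * δ) * ((X \ Z).card : ℝ) ≤
              (((X \ Z).filter fun x => ∃ k ∈ K a, H.Adj x k).card : ℝ) := by linarith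
          convert h9) s
      have hAhit : ∀ a, ∃ x ∈ A, ∃ k ∈ K a, H.Adj x k := by
        intro a
        by_contra hno
        have h2 : (1 - (1 - 2 * δ)) ^ s * ((Finset.univ : Finset (Fin j)).card : ℝ) ≤
            (t : ℝ) * (2 * δ) ^ s := by
          rw [Finset.card_univ, Fintype.card_fin, mul_comm, sub_sub_cancel]
          refine mul_le_mul_of_nonneg_right ?_ (by positivity)
          exact_mod_cast (by omega : j ≤ t)
        refine absurd (le_trans (Nat.one_le_cast.mpr (Finset.card_pos.mpr ⟨a, ?_⟩))
          (hAcov.trans h2)) (not_le.mpr hst)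
        exact hI₁ a (Finset.mem_univ a) fun x hx h => hno ⟨x, hx, h⟩
      obtain ⟨B, hB, hBs, I₂, -, hI₂, hBcov⟩ := exists_cover X hYne (fun x y => H.Adj x y) (p := 1 / 64)
        (by norm_num)
        (fun x hx => by
          have h1 := hYx x hx
          have h2 : (Y \ Z).card ≤ N := Finset.card_le_univ _
          have h3 : ((Y \ Z).card : ℝ) ≤ 64 * (((Y \ Z).filter (H.Adj x)).card : ℝ) := by
            exact_mod_cast h2.trans h1
          linarith) s
      have hmemU : ∀ v ∈ A ∪ B, v ∈ X ∪ Y ∧ v ∉ Z := by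
        intro v hv
        rcases Finset.mem_union.mp hv with hv | hv
        · have := Finset.mem_sdiff.mp (hA hv)
          exact ⟨Finset.mem_union_left _ this.1, this.2⟩
        · have := Finset.mem_sdiff.mp (hB hv)
          exact ⟨Finset.mem_union_right _ this.1, this.2⟩
      have hx₀' := Finset.mem_sdiff.mp hx₀
      have hex : ∀ v : V, ∃ L : Finset V, v ∈ A ∪ B → x₀ ∈ L ∧ v ∈ L ∧ ConnSet H (L : Set V) ∧
          L.card ≤ 5 ∧ Disjoint Z L := by
        intro v
        by_cases hv : v ∈ A ∪ B
        · obtain ⟨p, hp, hpZ⟩ := hwalk Z hZcard x₀ (Finset.mem_union_left _ hx₀'.1) v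
            (hmemU v hv).1 hx₀'.2 (hmemU v hv).2
          refine ⟨p.support.toFinset, fun _ => ⟨by simp, by simp, ?_, ?_, ?_⟩⟩
          · convert connSet_support p using 1
            ext w
            simp
          · refine (List.toFinset_card_le _).trans ?_
            rw [Walk.length_support]
            omega
          · rw [Finset.disjoint_right]
            intro w hw
            exact hpZ w (List.mem_toFinset.mp hw)
        · exact ⟨∅, fun h => absurd h hv⟩
      choose L hL using hex
      set K₀ : Finset V := insert x₀ ((A ∪ B).biUnion L) with hK₀
      have hABK : A ∪ B ⊆ K₀ := fun v hv =>
        Finset.mem_insert_of_mem (Finset.mem_biUnion.mpr ⟨v, hv, (hL v hv).2.1⟩)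
      have hK₀conn : ConnSet H (K₀ : Set V) := by
        refine connSet_of_center (x := x₀) (by simp [hK₀]) fun u hu => ?_
        rcases Finset.mem_insert.mp (Finset.mem_coe.mp hu) with rfl | hu'
        · exact ⟨Walk.nil, by simpa using hu⟩
        · obtain ⟨v, hv, huv⟩ := Finset.mem_biUnion.mp hu'
          obtain ⟨p, hp⟩ := (hL v hv).2.2.1.exists_walk (hL v hv).1 huv
          exact ⟨p, fun w hw =>
            Finset.mem_insert_of_mem (Finset.mem_biUnion.mpr ⟨v, hv, hp w hw⟩)⟩
      have hK₀card : K₀.card ≤ 11 * s := by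
        have h1 : ((A ∪ B).biUnion L).card ≤ (A ∪ B).card * 5 := by
          refine (Finset.card_biUnion_le).trans (Finset.sum_le_card_nsmul _ _ _ fun v hv => ?_)
          exact (hL v hv).2.2.2.1
        have h2 := Finset.card_union_le A B
        have h3 : K₀.card ≤ _ := Finset.card_insert_le _ _
        omega
      have hK₀Z : Disjoint Z K₀ := by
        rw [hK₀, Finset.disjoint_insert_right, Finset.disjoint_biUnion_right]
        exact ⟨hx₀'.2, fun v hv => (hL v hv).2.2.2.2⟩
      have hKZ : ∀ a, K a ⊆ Z := fun a => Finset.subset_biUnion_of_mem K (Finset.mem_univ a)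
      have hK₀dom : ((X.filter fun x => ∀ k ∈ K₀, ¬ H.Adj x k).card : ℝ) ≤
          δ * (X.card : ℝ) := by
        refine le_trans (Nat.cast_le.mpr (Finset.card_le_card ?_)) (hBcov.trans (le_of_eq ?_))
        · intro x hx
          rw [Finset.mem_filter] at hx
          exact hI₂ x hx.1 fun k hk => hx.2 k (hABK (Finset.mem_union_right _ hk))
        · norm_num [hδ]
      have hK₀adj : ∀ a, ∃ u ∈ K₀, ∃ v ∈ K a, H.Adj u v := by
        intro a
        obtain ⟨x, hx, k, hk, h⟩ := hAhit a
        exact ⟨x, hABK (Finset.mem_union_left _ hx), k, hk, h⟩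
      refine ⟨Fin.cons K₀ K, ?_, Fin.cases hK₀conn hconn, Fin.cases hK₀card hcard,
        Fin.cases hK₀dom hdom, ?_⟩
      · intro a b hab
        induction a using Fin.cases with
        | zero =>
          induction b using Fin.cases with
          | zero => exact absurd rfl hab
          | succ b => exact (hK₀Z.mono_left (hKZ b)).symm
        | succ a =>
          induction b using Fin.cases with
          | zero => exact hK₀Z.mono_left (hKZ a)
          | succ b => exact hdisj fun h => hab (congrArg Fin.succ h)
      · intro a b hab
        induction a using Fin.cases with
        | zero =>
          induction b using Fin.cases with
          | zero => exact absurd rfl hab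
          | succ b => exact hK₀adj b
        | succ a =>
          induction b using Fin.cases with
          | zero =>
            obtain ⟨u, hu, v, hv, h⟩ := hK₀adj a
            exact ⟨v, hv, u, hu, h.symm⟩
          | succ b => exact hadj a b fun h => hab (congrArg Fin.succ h)
  obtain ⟨K, hdisj, hconn, -, -, hadj⟩ := key t le_rfl
  exact ⟨fun a => K a, fun a b hab => Finset.disjoint_coe.mpr (hdisj hab), hconn,
    fun a b hab => hadj a b hab⟩

/-- A graph whose minimum degree is at least half its order has a large complete minor. -/
theorem minorOf_of_minDegree {V : Type*} [Fintype V] [Nonempty V] (H : SimpleGraph V) {s t : ℕ}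
    (hs : 1 ≤ s) (hN : 704 * s * t ≤ Fintype.card V)
    (hdeg : ∀ v, Fintype.card V ≤ 2 * (H.neighborSet v).ncard)
    (hst : (t : ℝ) * (2 * (63 / 64 : ℝ) ^ s) ^ s < 1) :
    MinorOf (completeGraph (Fin t)) H := by
  classical
  set N := Fintype.card V with hNdef
  have hNpos : 0 < N := Fintype.card_pos
  set nb : V → Finset V := fun v => Finset.univ.filter (H.Adj v) with hnb
  have hmem : ∀ v w, w ∈ nb v ↔ H.Adj v w := fun v w => by simp [hnb]
  have hdeg' : ∀ v, N ≤ 2 * (nb v).card := by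
    intro v
    refine (hdeg v).trans_eq ?_
    rw [← Set.ncard_coe_finset]
    congr 2
    ext w
    simp [hnb]
  by_cases hcase : ∃ a, N ≤ 16 * (Finset.univ.filter fun x => 16 * (nb x ∩ nb a).card < N).card
  · obtain ⟨a, ha⟩ := hcase
    set X := Finset.univ.filter fun x => 16 * (nb x ∩ nb a).card < N with hX
    set W := (nb a)ᶜ with hW
    set Y := W.filter fun w => X.card ≤ 2 * (X.filter (H.Adj w)).card with hY
    have hWcard : W.card + (nb a).card = N := by
      rw [hW, add_comm]
      exact Finset.card_add_card_compl _
    have ha2 := hdeg' a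
    have hXW : ∀ x ∈ X, 7 * N ≤ 16 * (W.filter (H.Adj x)).card := by
      intro x hx
      have h1 := (Finset.mem_filter.mp hx).2
      have h2 := hdeg' x
      have h3 : nb x = (nb x ∩ nb a) ∪ W.filter (H.Adj x) := by
        ext w
        simp only [hW, Finset.mem_union, Finset.mem_inter, Finset.mem_filter, Finset.mem_compl,
          hmem]
        tauto
      have h4 := Finset.card_union_le (nb x ∩ nb a) (W.filter (H.Adj x))
      rw [← h3] at h4
      omega
    have hXW' : ∀ x ∈ X, 16 * (W.filter fun w => ¬ H.Adj x w).card ≤ N := by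
      intro x hx
      have h1 := hXW x hx
      have h2 := Finset.card_filter_add_card_filter_not (s := W) (H.Adj x)
      omega
    have hbad : 8 * (W.filter fun w => ¬ X.card ≤ 2 * (X.filter (H.Adj w)).card).card ≤ N := by
      have hswap := Finset.sum_card_bipartiteAbove_eq_sum_card_bipartiteBelow
        (s := X) (t := W) (fun x w => ¬ H.Adj x w)
      simp only [Finset.bipartiteAbove, Finset.bipartiteBelow] at hswap
      set Bad := W.filter fun w => ¬ X.card ≤ 2 * (X.filter (H.Adj w)).card with hBad
      have h1 : Bad.card * X.card ≤ 2 * ∑ w ∈ W, (X.filter fun x => ¬ H.Adj x w).card := by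
        calc Bad.card * X.card = ∑ _w ∈ Bad, X.card := by simp
          _ ≤ ∑ w ∈ Bad, 2 * (X.filter fun x => ¬ H.Adj x w).card := by
            refine Finset.sum_le_sum fun w hw => ?_
            have h2 := (Finset.mem_filter.mp hw).2
            have h3 := Finset.card_filter_add_card_filter_not (s := X) (H.Adj w)
            have h4 : (X.filter fun x => ¬ H.Adj x w) = X.filter fun x => ¬ H.Adj w x := by
              simp only [H.adj_comm]
            rw [h4]
            omega
          _ ≤ ∑ w ∈ W, 2 * (X.filter fun x => ¬ H.Adj x w).card :=
            Finset.sum_le_sum_of_subset (Finset.filter_subset _ _)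
          _ = _ := by rw [Finset.mul_sum]
      have h2 : 16 * ∑ x ∈ X, (W.filter fun w => ¬ H.Adj x w).card ≤ X.card * N := by
        rw [Finset.mul_sum]
        refine (Finset.sum_le_card_nsmul _ _ _ hXW').trans ?_
        simp
      rw [hswap] at h2
      have h3 : X.card * (8 * Bad.card) ≤ X.card * N := by nlinarith
      exact Nat.le_of_mul_le_mul_left h3 (by omega)
    have hXY : ∀ x ∈ X, 5 * N ≤ 16 * (Y.filter (H.Adj x)).card := by
      intro x hx
      have h1 := hXW x hx
      have h2 : W.filter (H.Adj x) ⊆ Y.filter (H.Adj x) ∪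
          W.filter fun w => ¬ X.card ≤ 2 * (X.filter (H.Adj w)).card := by
        intro w hw
        simp only [hY, Finset.mem_union, Finset.mem_filter] at hw ⊢
        tauto
      have h3 := (Finset.card_le_card h2).trans (Finset.card_union_le _ _)
      omega
    have hcommon : ∀ x ∈ X, ∀ x' ∈ X, N ≤ 4 * ((Y.filter (H.Adj x)).filter (H.Adj x')).card := by
      intro x hx x' hx'
      have h1 := hXY x hx
      have h2 := hXW' x' hx'
      have h3 := Finset.card_filter_add_card_filter_not (s := Y.filter (H.Adj x)) (H.Adj x')
      have h4 : (Y.filter (H.Adj x)).filter (fun w => ¬ H.Adj x' w) ⊆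
          W.filter fun w => ¬ H.Adj x' w := by
        intro w hw
        simp only [hY, Finset.mem_filter] at hw ⊢
        tauto
      have h5 := Finset.card_le_card h4
      omega
    refine minorOf_of_robust H X Y hs hN (by omega) ?_ ?_ hst
    · intro x hx
      have := hXY x hx
      convert (by omega : N ≤ 32 * (Y.filter (H.Adj x)).card)
    · intro Z hZ u hu w hw huZ hwZ
      have hpick : ∀ S : Finset V, N < 64 * S.card → ∃ v ∈ S, v ∉ Z := by
        intro S hS
        exact Finset.exists_mem_notMem_of_card_lt_card (by omega)
      have hnear : ∀ u ∈ X ∪ Y, u ∉ Z → ∃ x ∈ X, ∃ p : H.Walk u x, p.length ≤ 1 ∧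
          ∀ v ∈ p.support, v ∉ Z := by
        intro u hu huZ
        rcases Finset.mem_union.mp hu with hu | hu
        · exact ⟨u, hu, Walk.nil, by simp, by simpa using huZ⟩
        · have h1 := (Finset.mem_filter.mp hu).2
          obtain ⟨x, hx, hxZ⟩ := hpick (X.filter (H.Adj u)) (by omega)
          rw [Finset.mem_filter] at hx
          exact ⟨x, hx.1, hx.2.toWalk, by simp, by simp [huZ, hxZ]⟩
      obtain ⟨x, hx, p, hp, hpZ⟩ := hnear u (by convert hu) huZ
      obtain ⟨x', hx', p', hp', hpZ'⟩ := hnear w (by convert hw) hwZ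
      obtain ⟨c, hc, hcZ⟩ := hpick _ (lt_of_lt_of_le (by omega)
        (Nat.mul_le_mul_left 16 (hcommon x hx x' hx')) |>.trans_eq (by ring))
      simp only [Finset.mem_filter] at hc
      refine ⟨p.append (Walk.cons hc.1.2 (Walk.cons hc.2.symm p'.reverse)), ?_, ?_⟩
      · simp only [Walk.length_append, Walk.length_cons, Walk.length_reverse]
        omega
      · intro v hv
        simp only [Walk.mem_support_append_iff, Walk.support_cons, List.mem_cons,
          Walk.support_reverse, List.mem_reverse] at hv
        rcases hv with hv | rfl | rfl | hv
        · exact hpZ v hv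
        · exact hpZ _ p.end_mem_support
        · exact hcZ
        · exact hpZ' v hv
  · push Not at hcase
    refine minorOf_of_robust H Finset.univ Finset.univ hs hN ?_ ?_ ?_ hst
    · rw [Finset.card_univ]
      omega
    · intro x _
      have := hdeg' x
      convert (by omega : N ≤ 32 * (nb x).card)
    · intro Z hZ u _ w _ huZ hwZ
      obtain ⟨z, hz, hzZ⟩ : ∃ z, (N ≤ 16 * (nb z ∩ nb u).card ∧ N ≤ 16 * (nb z ∩ nb w).card) ∧
          z ∉ Z := by
        by_contra! hno
        have h1 : (Finset.univ : Finset V) ⊆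
            (Finset.univ.filter (fun x => 16 * (nb x ∩ nb u).card < N) ∪
            Finset.univ.filter fun x => 16 * (nb x ∩ nb w).card < N) ∪ Z := by
          intro z _
          simp only [Finset.mem_union, Finset.mem_filter, Finset.mem_univ, true_and]
          by_cases hz1 : N ≤ 16 * (nb z ∩ nb u).card
          · by_cases hz2 : N ≤ 16 * (nb z ∩ nb w).card
            · exact Or.inr (hno z ⟨hz1, hz2⟩)
            · exact Or.inl (Or.inr (not_le.mp hz2))
          · exact Or.inl (Or.inl (not_le.mp hz1))
        have h2 := (Finset.card_le_card h1).trans ((Finset.card_union_le _ _).trans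
          (Nat.add_le_add_right (Finset.card_union_le _ _) _))
        rw [Finset.card_univ, ← hNdef] at h2
        have h3 := hcase u
        have h4 := hcase w
        omega
      obtain ⟨c, hc, hcZ⟩ : ∃ c ∈ nb z ∩ nb u, c ∉ Z :=
        Finset.exists_mem_notMem_of_card_lt_card (by omega)
      obtain ⟨c', hc', hcZ'⟩ : ∃ c ∈ nb z ∩ nb w, c ∉ Z :=
        Finset.exists_mem_notMem_of_card_lt_card (by omega)
      simp only [Finset.mem_inter, hmem] at hc hc'
      exact ⟨Walk.cons hc.2 (Walk.cons hc.1.symm (Walk.cons hc'.1 hc'.2.symm.toWalk)), by simp,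
        by simp [huZ, hwZ, hzZ, hcZ, hcZ']⟩

theorem exists_parameters {t : ℕ} (ht : 2 ≤ t) :
    ∃ s : ℕ, 1 ≤ s ∧ (s : ℝ) ≤ 130 * √(Real.log t) ∧
      (t : ℝ) * (2 * (63 / 64 : ℝ) ^ s) ^ s < 1 := by
  have ht' : (2 : ℝ) ≤ t := by exact_mod_cast ht
  have hlog2 := Real.log_two_gt_d9
  have hlog2' := Real.log_two_lt_d9
  have hlogt : Real.log 2 ≤ Real.log t := Real.log_le_log (by norm_num) ht'
  set r := √(Real.log t) with hr
  have hr2 : r ^ 2 = Real.log t := Real.sq_sqrt (by linarith)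
  have hr0 : 0 ≤ r := Real.sqrt_nonneg _
  have hr8 : (0.8 : ℝ) ≤ r := by
    rw [hr]
    exact Real.le_sqrt_of_sq_le (by norm_num; linarith)
  have hs1 := Nat.le_ceil (128 * r)
  have hs2 := Nat.ceil_lt_add_one (show 0 ≤ 128 * r by positivity)
  set s := ⌈128 * r⌉₊
  have hs3 : (1 : ℝ) ≤ s := by linarith
  refine ⟨s, by exact_mod_cast hs3, by linarith, ?_⟩
  have hlog : Real.log (63 / 64) ≤ -(1 / 64) := by
    have := Real.log_le_sub_one_of_pos (show (0 : ℝ) < 63 / 64 by norm_num)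
    linarith
  have hpos : 0 < (t : ℝ) * (2 * (63 / 64 : ℝ) ^ s) ^ s := by positivity
  rw [← Real.log_neg_iff hpos, Real.log_mul (by positivity) (by positivity), Real.log_pow,
    Real.log_mul (by norm_num) (by positivity), Real.log_pow]
  have h1 : Real.log 2 + (s : ℝ) * Real.log (63 / 64) ≤ -(s / 128) := by nlinarith
  have h2 := mul_le_mul_of_nonneg_left h1 (by linarith : (0 : ℝ) ≤ s)
  nlinarith

/-- **Kostochka–Thomason**: average degree of order `t * √(log t)` forces a complete minor on `t`
vertices. -/
theorem minorOf_of_ncard_edgeSet {t d : ℕ} (ht : 2 ≤ t)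
    (hd : 100000 * (t : ℝ) * √(Real.log t) ≤ d) {V : Type*} [Finite V] (G : SimpleGraph V)
    (hne : G.edgeSet.Nonempty) (hG : d * Nat.card V ≤ G.edgeSet.ncard) :
    MinorOf (completeGraph (Fin t)) G := by
  obtain ⟨s, hs, hs', hst⟩ := exists_parameters ht
  have h1 : 704 * s * t ≤ d := by
    have ht' : (0 : ℝ) ≤ t := by positivity
    have h2 := mul_le_mul_of_nonneg_right hs' ht'
    have h3 : 0 ≤ √(Real.log t) * t := by positivity
    have : ((704 * s * t : ℕ) : ℝ) ≤ d := by
      push_cast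
      linarith
    exact_mod_cast this
  have hd1 : 1 ≤ d := by nlinarith
  refine minorOf_of_small_dense ht hd1 ?_ _ _ G le_rfl le_rfl hne
    ((Nat.mul_le_mul_left d ?_).trans hG)
  · intro W _ _ H hW hdeg
    refine minorOf_of_minDegree H hs ?_ (fun v => hW.trans (Nat.mul_le_mul_left 2 (hdeg v))) hst
    obtain ⟨w⟩ := ‹Nonempty W›
    refine (h1.trans (hdeg w)).trans ?_
    rw [← Nat.card_eq_fintype_card, ← Set.ncard_univ]
    exact Set.ncard_le_ncard (Set.subset_univ _) (Set.toFinite _)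
  · rw [← Set.ncard_univ]
    exact Set.ncard_le_ncard (Set.subset_univ _) (Set.toFinite _)

/-- The intersection graph of an indexed family of paths. -/
def familyGraph {V I : Type} {G : SimpleGraph V} (f : I → PathIn G) : SimpleGraph I where
  Adj i j := i ≠ j ∧ ∃ v, v ∈ (f i).verts ∧ v ∈ (f j).verts
  symm := ⟨fun _ _ ⟨h, v, h1, h2⟩ => ⟨h.symm, v, h2, h1⟩⟩
  loopless := ⟨fun _ h => h.1 rfl⟩

theorem PathIn.fst_mem_verts {V : Type} {G : SimpleGraph V} (P : PathIn G) : P.1 ∈ P.verts :=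
  Walk.start_mem_support _

theorem PathIn.snd_mem_verts {V : Type} {G : SimpleGraph V} (P : PathIn G) : P.2.1 ∈ P.verts :=
  Walk.end_mem_support _

theorem injective_of_pairwise_disjoint_verts {V I : Type} {G : SimpleGraph V} {f : I → PathIn G}
    (hf : Pairwise fun i j => Disjoint (f i).verts (f j).verts) : Function.Injective f := by
  intro i j hij
  by_contra hne
  have : Disjoint (f i).verts (f j).verts := hf hne
  rw [hij] at this
  exact Set.disjoint_left.mp this (f j).fst_mem_verts (f j).fst_mem_verts

theorem isGridLikeMinor_range {V I : Type} {G : SimpleGraph V} {ℓ : ℕ} {f : I → PathIn G}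
    (hf : Function.Injective f) (color : I → Bool)
    (hcolor : ∀ i j, i ≠ j → color i = color j → Disjoint (f i).verts (f j).verts)
    (hm : MinorOf (completeGraph (Fin ℓ)) (familyGraph f)) :
    IsGridLikeMinor G ℓ (Set.range f) := by
  constructor
  · choose g hg using fun P : Set.range f => P.2
    have hC : (pathIntersectionGraph G (Set.range f)).Coloring Bool := by
      refine Coloring.mk (fun P => color (g P)) ?_
      intro P Q hPQ heq
      rw [pathIntersectionGraph, fromRel_adj] at hPQ
      obtain ⟨hne, h⟩ := hPQ
      have hd := hcolor (g P) (g Q) (fun h => hne (Subtype.ext (by rw [← hg P, ← hg Q, h]))) heq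
      rw [hg, hg] at hd
      rcases h with ⟨v, h1, h2⟩ | ⟨v, h1, h2⟩
      · exact Set.disjoint_left.mp hd h1 h2
      · exact Set.disjoint_left.mp hd h2 h1
    exact hC.colorable
  · refine hm.of_hom (⟨fun i => ⟨f i, i, rfl⟩, ?_⟩ : familyGraph f →g
      pathIntersectionGraph G (Set.range f)) fun i j hij => hf (congrArg Subtype.val hij)
    intro i j hij
    rw [pathIntersectionGraph, fromRel_adj]
    exact ⟨fun h => hij.1 (hf (congrArg Subtype.val h)), Or.inl hij.2⟩

/-- Two systems of disjoint paths with many intersections contain a grid-like minor. -/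
theorem exists_isGridLikeMinor_of_many_intersections {V : Type} {G : SimpleGraph V} {ℓ d n : ℕ}
    (hℓ : 2 ≤ ℓ) (hd : 100000 * (ℓ : ℝ) * √(Real.log ℓ) ≤ d) {Q Q' : Fin n → PathIn G}
    (hQ : Pairwise fun a b => Disjoint (Q a).verts (Q b).verts)
    (hQ' : Pairwise fun a b => Disjoint (Q' a).verts (Q' b).verts) (hne : ∀ a b, Q a ≠ Q' b)
    (h : 2 * d * n <
      {x : Fin n × Fin n | ∃ v, v ∈ (Q x.1).verts ∧ v ∈ (Q' x.2).verts}.ncard) :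
    ∃ 𝒬 : Set (PathIn G), IsGridLikeMinor G ℓ 𝒬 := by
  let f : Fin n ⊕ Fin n → PathIn G := Sum.elim Q Q'
  have hcard : {x : Fin n × Fin n | ∃ v, v ∈ (Q x.1).verts ∧ v ∈ (Q' x.2).verts}.ncard ≤
      (familyGraph f).edgeSet.ncard := by
    refine Set.ncard_le_ncard_of_injOn (fun x => s(Sum.inl x.1, Sum.inr x.2)) ?_ ?_
      (Set.toFinite _)
    · rintro ⟨a, b⟩ hab
      exact ⟨Sum.inl_ne_inr, hab⟩
    · rintro ⟨a, b⟩ - ⟨a', b'⟩ - hab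
      simpa using hab
  refine ⟨_, isGridLikeMinor_range (f := f) ?_ Sum.isLeft ?_ ?_⟩
  · exact (injective_of_pairwise_disjoint_verts hQ).sumElim
      (injective_of_pairwise_disjoint_verts hQ') hne
  · rintro (a | a) (b | b) hab hcol
    · exact hQ fun h => hab (congrArg _ h)
    · simp at hcol
    · simp at hcol
    · exact hQ' fun h => hab (congrArg _ h)
  · refine minorOf_of_ncard_edgeSet hℓ hd _ ?_ ?_
    · rw [← Set.ncard_pos (Set.toFinite _)]
      omega
    · rw [Nat.card_sum, Nat.card_fin]
      nlinarith

/-- Disjoint paths, together with disjoint paths joining any two of them, form a grid-like minor. -/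
theorem exists_isGridLikeMinor_of_disjoint {V : Type} {G : SimpleGraph V} {ℓ : ℕ}
    {P : Fin ℓ → PathIn G} (hP : Pairwise fun i j => Disjoint (P i).verts (P j).verts)
    {R : {x : Fin ℓ × Fin ℓ // x.1 < x.2} → PathIn G}
    (hR : Pairwise fun e e' => Disjoint (R e).verts (R e').verts)
    (hRP : ∀ e, (R e).1 ∈ (P e.1.1).verts ∧ (R e).2.1 ∈ (P e.1.2).verts) :
    ∃ 𝒬 : Set (PathIn G), IsGridLikeMinor G ℓ 𝒬 := by
  have hinc : ∀ {i j v}, v ∈ (P i).verts → v ∈ (P j).verts → i = j := by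
    intro i j v hi hj
    by_contra hij
    exact Set.disjoint_left.mp (hP hij) hi hj
  let f : Fin ℓ ⊕ {x : Fin ℓ × Fin ℓ // x.1 < x.2} → PathIn G := Sum.elim P R
  have hadj₁ : ∀ e, (familyGraph f).Adj (Sum.inl e.1.1) (Sum.inr e) := fun e =>
    ⟨Sum.inl_ne_inr, _, (hRP e).1, (R e).fst_mem_verts⟩
  have hadj₂ : ∀ e, (familyGraph f).Adj (Sum.inl e.1.2) (Sum.inr e) := fun e =>
    ⟨Sum.inl_ne_inr, _, (hRP e).2, (R e).snd_mem_verts⟩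
  refine ⟨_, isGridLikeMinor_range (f := f) ?_ Sum.isLeft ?_ ?_⟩
  · refine (injective_of_pairwise_disjoint_verts hP).sumElim
      (injective_of_pairwise_disjoint_verts hR) fun i e h => ?_
    have h1 := hinc (h ▸ (R e).fst_mem_verts : (R e).1 ∈ (P i).verts) (hRP e).1
    have h2 := hinc (h ▸ (R e).snd_mem_verts : (R e).2.1 ∈ (P i).verts) (hRP e).2
    exact e.2.ne (h1.symm.trans h2)
  · rintro (a | a) (b | b) hab hcol
    · exact hP fun h => hab (congrArg _ h)
    · simp at hcol
    · simp at hcol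
    · exact hR fun h => hab (congrArg _ h)
  · refine ⟨fun i => {x | Sum.elim id (fun e => e.1.1) x = i}, fun i j hij => ?_, fun i => ?_,
      fun i j hij => ?_⟩
    · exact Set.disjoint_left.mpr fun x hx hx' => hij (hx.symm.trans hx')
    · refine connSet_of_center (x := Sum.inl i) rfl ?_
      rintro (j | e) hx
      · obtain rfl : j = i := hx
        exact ⟨Walk.nil, by simp⟩
      · obtain rfl : e.1.1 = i := hx
        exact ⟨(hadj₁ e).toWalk, by simp⟩
    · rcases lt_or_gt_of_ne hij with h | h
      · exact ⟨Sum.inr ⟨(i, j), h⟩, rfl, Sum.inl j, rfl, (hadj₂ ⟨(i, j), h⟩).symm⟩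
      · exact ⟨Sum.inl i, rfl, Sum.inr ⟨(j, i), h⟩, rfl, hadj₂ ⟨(j, i), h⟩⟩

/-- **Theorem (Reed–Wood).** There is a constant `c > 0` such that every finite
graph with treewidth at least `c·ℓ⁴·√(log ℓ)` contains a grid-like-minor of
order `ℓ`, for every integer `ℓ ≥ 2`. -/
theorem gridLikeMinor_of_large_treewidth :
    ∃ c : ℝ, 0 < c ∧
      ∀ (ℓ : ℕ), 2 ≤ ℓ →
        ∀ (V : Type) [Fintype V] (G : SimpleGraph V),
          c * (ℓ : ℝ) ^ 4 * Real.sqrt (Real.log ℓ) ≤ (treewidth G : ℝ) →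
          ∃ 𝒬 : Set (PathIn G), IsGridLikeMinor G ℓ 𝒬 := by
  refine ⟨2500000, by norm_num, fun ℓ hℓ V _ G htw => ?_⟩
  have hℓ' : (2 : ℝ) ≤ ℓ := by exact_mod_cast hℓ
  have hlog := Real.log_two_gt_d9
  have hlog' : Real.log 2 ≤ Real.log ℓ := Real.log_le_log (by norm_num) hℓ'
  set r := √(Real.log ℓ) with hr
  have hr8 : (0.8 : ℝ) ≤ r := by
    rw [hr]
    exact Real.le_sqrt_of_sq_le (by norm_num; linarith)
  have hd := Nat.le_ceil (100000 * (ℓ : ℝ) * r)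
  have hd' := Nat.ceil_lt_add_one (show 0 ≤ 100000 * (ℓ : ℝ) * r by positivity)
  set d := ⌈100000 * (ℓ : ℝ) * r⌉₊ with hddef
  have hℓr : 1 ≤ (ℓ : ℝ) * r := by nlinarith
  have hdpos : 0 < d := by
    have : (0 : ℝ) < d := by linarith
    exact_mod_cast this
  set n := 8 * ℓ ^ 2 * d with hn
  have hnpos : 0 < n := by positivity
  have htw' : 3 * (ℓ * n) < treewidth G := by
    have hd2 : (d : ℝ) < 100001 * (ℓ * r) := by linarith
    have hℓ3 : (0 : ℝ) < (ℓ : ℝ) ^ 3 := by positivity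
    have h1 := mul_lt_mul_of_pos_left hd2 hℓ3
    have h2 : (0 : ℝ) < (ℓ : ℝ) ^ 4 * r := by positivity
    have h3 : ((3 * (ℓ * n) : ℕ) : ℝ) < treewidth G := by
      refine lt_of_lt_of_le ?_ htw
      rw [hn]
      push_cast
      nlinarith
    exact_mod_cast h3
  obtain ⟨P, hP, hQ⟩ := exists_linked_paths G hnpos htw'
  choose Q hQd hQP using hQ
  by_cases hcase : ∃ e e' : {x : Fin ℓ × Fin ℓ // x.1 < x.2}, e ≠ e' ∧ 2 * d * n <
      {x : Fin n × Fin n | ∃ v, v ∈ (Q e.1.1 e.1.2 x.1).verts ∧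
        v ∈ (Q e'.1.1 e'.1.2 x.2).verts}.ncard
  · obtain ⟨e, e', hne, h⟩ := hcase
    refine exists_isGridLikeMinor_of_many_intersections hℓ hd (hQd _ _) (hQd _ _) ?_ h
    intro a b hab
    have hinc : ∀ {i j v}, v ∈ (P i).verts → v ∈ (P j).verts → i = j := by
      intro i j v hi hj
      by_contra hij
      exact Set.disjoint_left.mp (hP hij) hi hj
    have h1 := hQP e.1.1 e.1.2 a
    have h2 := hQP e'.1.1 e'.1.2 b
    rw [← hab] at h2
    exact hne (Subtype.ext (Prod.ext (hinc h1.1 h2.1) (hinc h1.2 h2.2)))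
  · push Not at hcase
    have : Nonempty (Fin n) := ⟨⟨0, hnpos⟩⟩
    obtain ⟨m, hm⟩ := exists_transversal (E := {x : Fin ℓ × Fin ℓ // x.1 < x.2}) (F := Fin n)
      (fun e e' a b => ∃ v, v ∈ (Q e.1.1 e.1.2 a).verts ∧ v ∈ (Q e'.1.1 e'.1.2 b).verts)
      (fun _ _ _ _ ⟨v, h1, h2⟩ => ⟨v, h2, h1⟩) (2 * d * n) hcase (by
        have hE : Fintype.card {x : Fin ℓ × Fin ℓ // x.1 < x.2} ≤ ℓ ^ 2 := by
          refine (Fintype.card_subtype_le _).trans_eq ?_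
          simp [sq]
        calc 4 * Fintype.card {x : Fin ℓ × Fin ℓ // x.1 < x.2} * (2 * d * n)
            ≤ 4 * ℓ ^ 2 * (2 * d * n) := by gcongr
          _ = n * n := by
            rw [hn]
            ring
          _ = Fintype.card (Fin n) ^ 2 := by rw [Fintype.card_fin, sq])
    refine exists_isGridLikeMinor_of_disjoint hP (R := fun e => Q e.1.1 e.1.2 (m e)) ?_
      fun e => hQP _ _ _
    intro e e' hne
    exact Set.disjoint_left.mpr fun v h1 h2 => hm e e' hne ⟨v, h1, h2⟩
end

section
/- If a finite simple graph G contains a grid-like-minor of order ℓ, then the treewidth of G is at least ⌈ℓ/2⌉ − 1. -/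
open SimpleGraph

/-- A set of vertices is path-convex if it contains every path between two of its members. -/
def PathConvex {ι : Type*} (T : SimpleGraph ι) (A : Set ι) : Prop :=
  ∀ ⦃u v : ι⦄ (p : T.Walk u v), p.IsPath → u ∈ A → v ∈ A → ∀ x ∈ p.support, x ∈ A

theorem PathConvex.inter {ι : Type*} {T : SimpleGraph ι} {A B : Set ι} (hA : PathConvex T A)
    (hB : PathConvex T B) : PathConvex T (A ∩ B) :=
  fun _ _ p hp hu hv x hx => ⟨hA p hp hu.1 hv.1 x hx, hB p hp hu.2 hv.2 x hx⟩

theorem SimpleGraph.IsAcyclic.support_subset_of_isPath {ι : Type*} {T : SimpleGraph ι}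
    (hT : T.IsAcyclic) {u v : ι} {p : T.Walk u v} (hp : p.IsPath) (q : T.Walk u v) :
    p.support ⊆ q.support := by
  classical
  have h : p = q.bypass :=
    congrArg Subtype.val ((hT.subsingleton_path u v).elim ⟨p, hp⟩ ⟨q.bypass, q.bypass_isPath⟩)
  rw [h]
  exact q.support_bypass_subset_support

theorem SimpleGraph.IsAcyclic.pathConvex_of_connected {ι : Type*} {T : SimpleGraph ι}
    (hT : T.IsAcyclic) {A : Set ι} (hA : (T.induce A).Connected) : PathConvex T A := by
  intro u v p hp hu hv x hx
  obtain ⟨q⟩ := hA.preconnected ⟨u, hu⟩ ⟨v, hv⟩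
  have hx' := hT.support_subset_of_isPath hp (q.map (Embedding.induce A).toHom) hx
  erw [Walk.support_map, List.mem_map] at hx'
  obtain ⟨y, -, rfl⟩ := hx'
  exact y.2

theorem SimpleGraph.Walk.exists_mem_inter_or_exists_adj {ι : Type*} {T : SimpleGraph ι}
    {A B : Set ι} {u v : ι} (p : T.Walk u v) (hp : ∀ x ∈ p.support, x ∈ A ∪ B)
    (hu : u ∈ B) (hv : v ∈ A) :
    (∃ x ∈ p.support, x ∈ A ∩ B) ∨ ∃ x y, T.Adj x y ∧ x ∈ B \ A ∧ y ∈ A \ B := by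
  induction p with
  | nil => exact .inl ⟨_, by simp, hv, hu⟩
  | @cons u w v h p ih =>
    by_cases huA : u ∈ A
    · exact .inl ⟨u, by simp, huA, hu⟩
    by_cases hw : w ∈ B
    · obtain ⟨x, hx, hx'⟩ | h' := ih (fun x hx => hp x (by simp [hx])) hw hv
      · exact .inl ⟨x, by simp [hx], hx'⟩
      · exact .inr h'
    · exact .inr ⟨u, w, h, ⟨hu, huA⟩, (hp w (by simp)).resolve_right hw, hw⟩

/-- Three pairwise intersecting path-convex sets in a tree have a common vertex. -/
theorem SimpleGraph.IsTree.exists_mem_inter_of_pathConvex {ι : Type*} {T : SimpleGraph ι}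
    (hT : T.IsTree) {A B C : Set ι} (hA : PathConvex T A) (hB : PathConvex T B)
    (hC : PathConvex T C) (hAB : (A ∩ B).Nonempty) (hBC : (B ∩ C).Nonempty)
    (hAC : (A ∩ C).Nonempty) : (A ∩ B ∩ C).Nonempty := by
  obtain ⟨c, hcA, hcB⟩ := hAB
  obtain ⟨a, haB, haC⟩ := hBC
  obtain ⟨b, hbA, hbC⟩ := hAC
  obtain ⟨p, hp⟩ := hT.connected.exists_isPath a b
  have through_c : ∀ x ∈ B, ∀ y ∈ A, ∃ q : T.Walk x c, ∃ r : T.Walk c y,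
      (∀ z ∈ q.support, z ∈ B) ∧ ∀ z ∈ r.support, z ∈ A := by
    intro x hx y hy
    obtain ⟨q, hq⟩ := hT.connected.exists_isPath x c
    obtain ⟨r, hr⟩ := hT.connected.exists_isPath c y
    exact ⟨q, r, hB q hq hx hcB, hA r hr hcA hy⟩
  have hpAB : ∀ x ∈ p.support, x ∈ A ∪ B := by
    intro x hx
    obtain ⟨q, r, hq, hr⟩ := through_c a haB b hbA
    have hx' := hT.isAcyclic.support_subset_of_isPath hp (q.append r) hx
    rw [Walk.mem_support_append_iff] at hx'
    exact hx'.elim (fun h => .inr (hq x h)) (fun h => .inl (hr x h))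
  obtain ⟨x, hx, hxAB⟩ | ⟨x, y, hxy, hx, hy⟩ := p.exists_mem_inter_or_exists_adj hpAB haB hbA
  · exact ⟨x, hxAB, hC p hp haC hbC x hx⟩
  · obtain ⟨q, r, hq, hr⟩ := through_c x hx.1 y hy.1
    have h := isBridge_iff_forall_walk_mem_edges.1
      (isAcyclic_iff_forall_adj_isBridge.1 hT.isAcyclic hxy) (q.append r)
    rw [Walk.edges_append, List.mem_append] at h
    rcases h with h | h
    · exact absurd (hq y (q.snd_mem_support_of_mem_edges h)) hy.2
    · exact absurd (hr x (r.fst_mem_support_of_mem_edges h)) hx.2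

/-- The Helly property of finite families of path-convex sets in a tree. -/
theorem SimpleGraph.IsTree.exists_forall_mem_of_pathConvex {ι α : Type*} {T : SimpleGraph ι}
    (hT : T.IsTree) {s : Finset α} (hs : s.Nonempty) (f : α → Set ι)
    (hf : ∀ a ∈ s, PathConvex T (f a)) (hff : ∀ a ∈ s, ∀ b ∈ s, (f a ∩ f b).Nonempty) :
    ∃ x, ∀ a ∈ s, x ∈ f a := by
  induction hs using Finset.Nonempty.cons_induction generalizing f with
  | singleton a =>
    obtain ⟨x, hx, -⟩ := hff a (by simp) a (by simp)
    exact ⟨x, by simpa using hx⟩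
  | cons a s ha hs ih =>
    simp only [Finset.mem_cons, forall_eq_or_imp] at hf hff
    obtain ⟨x, hx⟩ := ih (fun b => f b ∩ f a) (fun b hb => (hf.2 b hb).inter hf.1) (by
      intro b hb c hc
      obtain ⟨y, ⟨hyb, hyc⟩, hya⟩ := hT.exists_mem_inter_of_pathConvex (hf.2 b hb) (hf.2 c hc)
        hf.1 ((hff.2 b hb).2 c hc) (hff.2 c hc).1 (hff.2 b hb).1
      exact ⟨y, ⟨hyb, hya⟩, hyc, hya⟩)
    obtain ⟨b, hb⟩ := hs
    refine ⟨x, ?_⟩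
    simp only [Finset.mem_cons, forall_eq_or_imp]
    exact ⟨(hx b hb).2, fun c hc => (hx c hc).1⟩

theorem SimpleGraph.Walk.connected_induce_biUnion_support {ι W : Type*} {T : SimpleGraph ι}
    {H : SimpleGraph W} {f : W → Set ι} (hf : ∀ w, (T.induce (f w)).Connected)
    (hadj : ∀ u v, H.Adj u v → (f u ∩ f v).Nonempty) {u v : W} (p : H.Walk u v) :
    (T.induce (⋃ w ∈ p.support, f w)).Connected := by
  induction p with
  | @nil u =>
    have : (⋃ z ∈ (Walk.nil : H.Walk u u).support, f z) = f u := by simp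
    rw [this]
    exact hf u
  | @cons u w v h p ih =>
    have : (⋃ z ∈ (Walk.cons h p).support, f z) = f u ∪ ⋃ z ∈ p.support, f z := by
      ext; simp
    rw [this]
    refine induce_union_connected (hf u).preconnected ih.preconnected ?_
    exact (hadj u w h).mono (Set.inter_subset_inter_right _
      (Set.subset_biUnion_of_mem (u := f) p.start_mem_support))

/-- A family of connected sets indexed by a connected graph, in which adjacent members
intersect, has a connected union. -/
theorem SimpleGraph.Connected.connected_induce_iUnion {ι W : Type*} {T : SimpleGraph ι}
    {H : SimpleGraph W} (hH : H.Connected) {f : W → Set ι}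
    (hf : ∀ w, (T.induce (f w)).Connected)
    (hadj : ∀ u v, H.Adj u v → (f u ∩ f v).Nonempty) :
    (T.induce (⋃ w, f w)).Connected := by
  obtain ⟨a⟩ := hH.nonempty
  obtain ⟨x, hx⟩ := (hf a).nonempty
  refine induce_connected_of_patches x (Set.mem_iUnion_of_mem a hx) fun {y} hy => ?_
  obtain ⟨b, hb⟩ := Set.mem_iUnion.1 hy
  obtain ⟨p⟩ := hH.preconnected a b
  exact ⟨⋃ w ∈ p.support, f w, Set.iUnion₂_subset fun w _ => Set.subset_iUnion f w,
    Set.mem_biUnion p.start_mem_support hx, Set.mem_biUnion p.end_mem_support hb,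
    (p.connected_induce_biUnion_support hf hadj).preconnected _ _⟩

theorem TreeDecomp.connected_induce_bags {V : Type} {G : SimpleGraph V} (td : TreeDecomp G)
    {X : Set V} (hX : (G.induce X).Connected) :
    (td.tree.induce (⋃ v : X, {i | (v : V) ∈ td.bag i})).Connected :=
  hX.connected_induce_iUnion (fun v => td.connected_bag v) fun u v h => td.adj_bag u v h

theorem PathIn.connected_induce_verts {V : Type} {G : SimpleGraph V} (P : PathIn G) :
    (G.induce P.verts).Connected :=
  (P.2.2 : G.Walk P.1 P.2.1).connected_induce_support

theorem pathIntersectionGraph_adj {V : Type} {G : SimpleGraph V} {𝒬 : Set (PathIn G)}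
    {P Q : 𝒬} : (pathIntersectionGraph G 𝒬).Adj P Q ↔
      P ≠ Q ∧ ∃ v, v ∈ (P : PathIn G).verts ∧ v ∈ (Q : PathIn G).verts := by
  rw [pathIntersectionGraph, fromRel_adj]
  refine and_congr_right fun _ => or_iff_left_of_imp ?_
  exact fun ⟨v, hQ, hP⟩ => ⟨v, hP, hQ⟩

theorem TreeDecomp.card_bag_le {V : Type} [Fintype V] {G : SimpleGraph V} (td : TreeDecomp G)
    (i : td.ι) : (td.bag i).card ≤ td.width + 1 := by
  have h : (td.bag i).card ≤ sSup {n | ∃ i, n = (td.bag i).card} :=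
    le_csSup ⟨Fintype.card V, by rintro _ ⟨j, rfl⟩; exact Finset.card_le_univ _⟩ ⟨i, rfl⟩
  rw [TreeDecomp.width]
  omega

theorem exists_treeDecomp_width_eq_treewidth {V : Type} [Fintype V] (G : SimpleGraph V) :
    ∃ td : TreeDecomp G, td.width = treewidth G := by
  let td : TreeDecomp G :=
    { ι := Unit
      tree := ⊥
      isTree := .of_subsingleton
      bag := fun _ => Finset.univ
      mem_bag := by simp
      adj_bag := by simp
      connected_bag := fun v =>
        haveI : Nonempty {i : Unit | v ∈ (Finset.univ : Finset V)} := ⟨⟨(), by simp⟩⟩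
        .of_subsingleton }
  exact Nat.sInf_mem (s := {w | ∃ td : TreeDecomp G, td.width = w}) ⟨td.width, td, rfl⟩

/-- Some bag meets a path of every branch set of a complete minor in the intersection graph. -/
theorem TreeDecomp.exists_bag_hits_branchSets {V : Type} {G : SimpleGraph V} (td : TreeDecomp G)
    {𝒬 : Set (PathIn G)} {ℓ : ℕ} (B : Fin ℓ → Set 𝒬)
    (hconn : ∀ a, ((pathIntersectionGraph G 𝒬).induce (B a)).Connected)
    (hadj : ∀ a b, a ≠ b → ∃ P ∈ B a, ∃ Q ∈ B b, (pathIntersectionGraph G 𝒬).Adj P Q) :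
    ∃ i, ∀ a, ∃ P ∈ B a, ∃ v ∈ td.bag i, v ∈ (P : PathIn G).verts := by
  rcases ℓ.eq_zero_or_pos with rfl | hℓ
  · obtain ⟨i⟩ := td.isTree.connected.nonempty
    exact ⟨i, fun a => a.elim0⟩
  let F : 𝒬 → Set td.ι := fun P => ⋃ v : (P : PathIn G).verts, {i | (v : V) ∈ td.bag i}
  have hF : ∀ P Q, (pathIntersectionGraph G 𝒬).Adj P Q → (F P ∩ F Q).Nonempty := by
    intro P Q h
    obtain ⟨-, v, hP, hQ⟩ := pathIntersectionGraph_adj.1 h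
    obtain ⟨i, hi⟩ := td.mem_bag v
    exact ⟨i, Set.mem_iUnion.2 ⟨⟨v, hP⟩, hi⟩, Set.mem_iUnion.2 ⟨⟨v, hQ⟩, hi⟩⟩
  have hT : ∀ a, (td.tree.induce (⋃ P : B a, F P)).Connected := fun a =>
    (hconn a).connected_induce_iUnion
      (fun P => td.connected_induce_bags (PathIn.connected_induce_verts _))
      fun P Q h => hF P Q h
  obtain ⟨i, hi⟩ := td.isTree.exists_forall_mem_of_pathConvex
    (s := (Finset.univ : Finset (Fin ℓ))) ⟨⟨0, hℓ⟩, by simp⟩ (fun a => ⋃ P : B a, F P)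
    (fun a _ => td.isTree.isAcyclic.pathConvex_of_connected (hT a)) (by
      intro a _ b _
      by_cases hab : a = b
      · subst hab
        obtain ⟨x⟩ := (hT a).nonempty
        exact ⟨x, x.2, x.2⟩
      · obtain ⟨P, hP, Q, hQ, h⟩ := hadj a b hab
        exact (hF P Q h).mono (Set.inter_subset_inter
          (Set.subset_iUnion (fun P : B a => F P) ⟨P, hP⟩)
          (Set.subset_iUnion (fun Q : B b => F Q) ⟨Q, hQ⟩)))
  refine ⟨i, fun a => ?_⟩
  obtain ⟨P, hP⟩ := Set.mem_iUnion.1 (hi a (Finset.mem_univ a))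
  obtain ⟨v, hv⟩ := Set.mem_iUnion.1 hP
  exact ⟨P, P.2, v, hv, v.2⟩

/-- If `G` contains a grid-like-minor of order `ℓ`, then the treewidth of `G`
is at least `⌈ℓ/2⌉ - 1`. -/
theorem treewidth_ge_of_gridLikeMinor {V : Type} [Fintype V] (G : SimpleGraph V)
    (ℓ : ℕ) (𝒬 : Set (PathIn G)) (h : IsGridLikeMinor G ℓ 𝒬) :
    (ℓ + 1) / 2 - 1 ≤ treewidth G := by
  obtain ⟨⟨c⟩, B, hdisj, hconn, hadj⟩ := h
  obtain ⟨td, htd⟩ := exists_treeDecomp_width_eq_treewidth G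
  obtain ⟨i, hi⟩ := td.exists_bag_hits_branchSets B hconn fun a b hab => hadj a b hab
  choose P hP v hv hvP using hi
  have hinj : Function.Injective fun a => ((⟨v a, hv a⟩ : td.bag i), c (P a)) := by
    intro a b hab
    simp only [Prod.mk.injEq, Subtype.mk.injEq] at hab
    have hPQ : P a = P b := by
      by_contra hne
      exact c.valid (pathIntersectionGraph_adj.2 ⟨hne, v a, hvP a, hab.1 ▸ hvP b⟩) hab.2
    by_contra hne
    exact Set.disjoint_left.1 (hdisj hne) (hP a) (hPQ ▸ hP b)
  have hcard := Fintype.card_le_of_injective _ hinj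
  simp only [Fintype.card_fin, Fintype.card_prod, Fintype.card_coe] at hcard
  have := td.card_bag_le i
  omega
end
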